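/- (Appendix D Proposition, t = 1 part.) Let Δ > 0, α > 0, θ ∈ [0,1/2). For each N ≥ 1 set M = ⌈αN⌉ and generate training data as follows: y_μ^true ∈ {0,1} are i.i.d. with P(y_μ^true = 1) = 1/2; y_μ ≠ y_μ^true with probability θ independently; x_μ = (2y_μ^true − 1)·v/√N + √Δ·z_μ with v = (1,…,1)^⊤ ∈ ℝ^N and z_μ i.i.d. standard Gaussian vectors in ℝ^N. Let ŵ⁰ = (1/M)·Σ_{μ=1}^M (2y_μ − 1)·x_μ and let the one-step self-distilled estimator be ŵ¹ = (1/M)·Σ_{μ=1}^M ( (x_μ·ŵ⁰)/√N )·x_μ. Let E¹_N be the conditional misclassification probability P( sign(ŵ¹·x) ≠ 2y^true − 1 | training data ) for an independent test pair (x, y^true) generated in the same way. Then as N → ∞, E¹_N converges in probability to H( α(Δ + α + Δα)(1 − 2θ) / √( Δ·[ (α² + 3α + 1)·Δ³·α + α²·( Δ²(α² + 5α + 3) + Δ(2α + 3)α + α² )·(1 − 2θ)² ] ) ). -/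

import Mathlib

open MeasureTheory ProbabilityTheory Filter

/-- The standard Gaussian tail function `H(x) = ∫_x^∞ e^{−t²/2}/√(2π) dt`. -/
noncomputable def Hfun (x : ℝ) : ℝ :=
  ∫ t in Set.Ioi x, Real.exp (-t ^ 2 / 2) / Real.sqrt (2 * Real.pi)

/-- Bernoulli measure on `ℝ`: mass `p` at `1` and `1 − p` at `0`. -/
noncomputable def bern (p : ℝ) : Measure ℝ :=
  ENNReal.ofReal p • Measure.dirac 1 + ENNReal.ofReal (1 - p) • Measure.dirac 0

/-- The law of a standard Gaussian vector in `ℝ^N` (i.i.d. `N(0,1)` coordinates). -/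
noncomputable def stdGaussianVec (N : ℕ) : Measure (Fin N → ℝ) :=
  Measure.pi fun _ => gaussianReal 0 1

/-- Sample space of the training data: true labels, flip indicators and noise vectors. -/
abbrev TrainSpace (N M : ℕ) := (Fin M → ℝ) × (Fin M → ℝ) × (Fin M → Fin N → ℝ)

/-- Law of the training data for balanced classes (`ρ = 1/2`) with label-noise rate `θ`:
i.i.d. Bernoulli(1/2) true labels, i.i.d. Bernoulli(θ) flip indicators,
i.i.d. standard Gaussian noise vectors, all jointly independent. -/
noncomputable def trainMeasure (N M : ℕ) (θ : ℝ) : Measure (TrainSpace N M) :=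
  (Measure.pi fun _ : Fin M => bern (1 / 2)).prod
    ((Measure.pi fun _ : Fin M => bern θ).prod (Measure.pi fun _ : Fin M => stdGaussianVec N))

/-- The observed (noisy) label `y_μ`: the true label `ω.1 μ`, flipped when the flip
indicator `ω.2.1 μ` equals `1`. -/
noncomputable def obsLabel {N M : ℕ} (ω : TrainSpace N M) (μ : Fin M) : ℝ :=
  if ω.2.1 μ = 1 then 1 - ω.1 μ else ω.1 μ

/-- The feature vector `x_μ = (2y_μ^true − 1)·v/√N + √Δ·z_μ` with `v = (1,…,1)ᵀ`. -/
noncomputable def dataVec {N M : ℕ} (Δ : ℝ) (ω : TrainSpace N M) (μ : Fin M) : Fin N → ℝ :=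
  fun i => (2 * ω.1 μ - 1) * 1 / Real.sqrt N + Real.sqrt Δ * ω.2.2 μ i

/-- The averaging estimator `ŵ⁰ = (1/M)·Σ_μ (2y_μ − 1)·x_μ`. -/
noncomputable def w0 {N M : ℕ} (Δ : ℝ) (ω : TrainSpace N M) : Fin N → ℝ :=
  fun i => (1 / (M : ℝ)) * ∑ μ, (2 * obsLabel ω μ - 1) * dataVec Δ ω μ i

/-- Law of an independent test pair `(x, y^true)`: `y^true ~ Bernoulli(1/2)` and
`x = (2y^true − 1)·v/√N + √Δ·z` with `z` a standard Gaussian vector. -/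
noncomputable def testMeasure (N : ℕ) (Δ : ℝ) : Measure ((Fin N → ℝ) × ℝ) :=
  Measure.map
    (fun p : ℝ × (Fin N → ℝ) =>
      (fun i => (2 * p.1 - 1) * 1 / Real.sqrt N + Real.sqrt Δ * p.2 i, p.1))
    ((bern (1 / 2)).prod (stdGaussianVec N))

/-- The conditional misclassification probability given the training data, i.e. the
probability over an independent test pair `(x, y^true)` that `sign(w·x) ≠ 2y^true − 1`. -/
noncomputable def genErr (N : ℕ) (Δ : ℝ) (w : Fin N → ℝ) : ℝ :=
  (testMeasure N Δ {p | Real.sign (∑ i, w i * p.1 i) ≠ 2 * p.2 - 1}).toReal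

/-- The one-step self-distilled estimator
`ŵ¹ = (1/M)·Σ_μ ((x_μ·ŵ⁰)/√N)·x_μ`. -/
noncomputable def w1 {N M : ℕ} (Δ : ℝ) (ω : TrainSpace N M) : Fin N → ℝ :=
  fun i => (1 / (M : ℝ)) *
    ∑ μ, ((∑ j, dataVec Δ ω μ j * w0 Δ ω j) / Real.sqrt N) * dataVec Δ ω μ i

open scoped Matrix

/-- The standard Gaussian measure on `ι → ℝ`. -/
noncomputable abbrev gaussPi (ι : Type*) [Fintype ι] : Measure (ι → ℝ) :=
  Measure.pi fun _ => gaussianReal 0 1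

section Gaussian

variable {ι κ : Type*} [Fintype ι] [Fintype κ]

lemma integral_exp_dotProduct_gaussPi (a : ι → ℝ) :
    ∫ z, Complex.exp ((a ⬝ᵥ z : ℝ) * Complex.I) ∂gaussPi ι
      = Complex.exp (-((a ⬝ᵥ a : ℝ) : ℂ) / 2) := by
  have h (z : ι → ℝ) : Complex.exp ((a ⬝ᵥ z : ℝ) * Complex.I)
      = ∏ i, Complex.exp ((a i : ℂ) * (z i : ℂ) * Complex.I) := by
    rw [← Complex.exp_sum, ← Finset.sum_mul]
    simp [dotProduct]
  simp_rw [h]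
  rw [integral_fintype_prod_eq_prod
    (f := fun i (x : ℝ) => Complex.exp ((a i : ℂ) * (x : ℂ) * Complex.I))]
  simp_rw [← charFun_apply_real, charFun_gaussianReal, ← Complex.exp_sum]
  congr 1
  simp [dotProduct, Finset.sum_div, neg_div, pow_two]

lemma map_dotProduct_gaussPi (a : ι → ℝ) (σ : ℝ) (hσ : σ ^ 2 = a ⬝ᵥ a) :
    (gaussPi ι).map (fun z => a ⬝ᵥ z) = (gaussianReal 0 1).map (fun t => σ * t) := by
  have hm : Measurable fun z : ι → ℝ => a ⬝ᵥ z := by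
    simp only [dotProduct]; fun_prop
  have := Measure.isProbabilityMeasure_map (μ := gaussPi ι) hm.aemeasurable
  have := Measure.isProbabilityMeasure_map (μ := gaussianReal 0 1) (f := fun t => σ * t)
    (by fun_prop)
  refine Measure.ext_of_charFun (funext fun t => ?_)
  rw [gaussianReal_map_const_mul, charFun_gaussianReal, charFun_apply_real,
    integral_map hm.aemeasurable (by fun_prop)]
  have h (z : ι → ℝ) : Complex.exp (t * (a ⬝ᵥ z : ℝ) * Complex.I)
      = Complex.exp (((t • a) ⬝ᵥ z : ℝ) * Complex.I) := by simp
  simp_rw [h, integral_exp_dotProduct_gaussPi]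
  congr 1
  simp only [smul_dotProduct, dotProduct_smul, ← hσ]
  simp
  ring

/-- Splitting a standard Gaussian vector along a unit vector `c` and its orthogonal complement,
with independent noise in the two parts, gives again a standard Gaussian vector. -/
lemma measurePreserving_split (c : ι → ℝ) (hc : c ⬝ᵥ c = 1) :
    MeasurePreserving (fun p : ℝ × (ι → ℝ) => p.1 • c + (p.2 - (c ⬝ᵥ p.2) • c))
      ((gaussianReal 0 1).prod (gaussPi ι)) (gaussPi ι) := by
  have hm : Measurable (fun p : ℝ × (ι → ℝ) => p.1 • c + (p.2 - (c ⬝ᵥ p.2) • c)) := by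
    simp only [dotProduct]; fun_prop
  refine ⟨hm, ?_⟩
  have := Measure.isProbabilityMeasure_map (μ := (gaussianReal 0 1).prod (gaussPi ι))
    hm.aemeasurable
  refine charFun_eq_pi_iff.1 fun t => ?_
  rw [Measure.map_map (by fun_prop) hm, charFun_apply,
    integral_map ((show Measurable (WithLp.toLp 2 : (ι → ℝ) → PiLp 2 fun _ => ℝ) by
      fun_prop).comp hm).aemeasurable (by fun_prop)]
  set τ : ι → ℝ := fun i => t i with hτ
  set d := c ⬝ᵥ τ with hd
  have h (p : ℝ × (ι → ℝ)) : Complex.exp ((inner ℝ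
      ((WithLp.toLp 2 ∘ fun p : ℝ × (ι → ℝ) => p.1 • c + (p.2 - (c ⬝ᵥ p.2) • c)) p) t : ℝ)
        * Complex.I)
      = Complex.exp (d * (p.1 : ℂ) * Complex.I)
        * Complex.exp (((τ - d • c) ⬝ᵥ p.2 : ℝ) * Complex.I) := by
    rw [← Complex.exp_add, ← add_mul]
    congr 2
    have : (inner ℝ ((WithLp.toLp 2 ∘ fun p : ℝ × (ι → ℝ) =>
        p.1 • c + (p.2 - (c ⬝ᵥ p.2) • c)) p) t : ℝ)
        = (p.1 • c + (p.2 - (c ⬝ᵥ p.2) • c)) ⬝ᵥ τ := by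
      simp [PiLp.inner_apply, dotProduct, hτ, mul_comm]
    rw [this]
    norm_cast
    simp only [add_dotProduct, sub_dotProduct, smul_dotProduct, smul_eq_mul, ← hd,
      dotProduct_comm p.2 τ]
    ring
  simp_rw [h]
  rw [integral_prod_mul (fun x : ℝ => Complex.exp (d * (x : ℂ) * Complex.I))
    (fun z : ι → ℝ => Complex.exp (((τ - d • c) ⬝ᵥ z : ℝ) * Complex.I)),
    integral_exp_dotProduct_gaussPi, ← charFun_apply_real, charFun_gaussianReal]
  simp_rw [charFun_gaussianReal]
  rw [← Complex.exp_sum, ← Complex.exp_add]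
  congr 1
  have h1 : (τ - d • c) ⬝ᵥ (τ - d • c) = τ ⬝ᵥ τ - d ^ 2 := by
    simp only [sub_dotProduct, dotProduct_sub, smul_dotProduct, dotProduct_smul, smul_eq_mul, hc,
      dotProduct_comm τ c, ← hd]
    ring
  rw [h1]
  simp only [dotProduct, hτ]
  push_cast
  simp [Finset.sum_neg_distrib, ← Finset.sum_div, pow_two]
  ring

lemma measurePreserving_curry_gaussPi (ι κ : Type*) [Fintype ι] [Fintype κ] :
    MeasurePreserving (MeasurableEquiv.curry ι κ ℝ) (gaussPi (ι × κ))
      (Measure.pi fun _ : ι => gaussPi κ) := by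
  refine ⟨MeasurableEquiv.measurable _, ?_⟩
  have := Measure.infinitePi_map_curry (fun (_ : ι) (_ : κ) => gaussianReal 0 1)
  simpa only [Measure.infinitePi_eq_pi] using this

lemma measurePreserving_gaussPi_swap :
    MeasurePreserving (fun (Z : ι → κ → ℝ) j i => Z i j)
      (Measure.pi fun _ : ι => gaussPi κ) (Measure.pi fun _ : κ => gaussPi ι) := by
  have hs : MeasurePreserving (fun (z : ι × κ → ℝ) (p : κ × ι) => z p.swap)
      (gaussPi (ι × κ)) (gaussPi (κ × ι)) := by
    have := measurePreserving_piCongrLeft (fun _ : κ × ι => gaussianReal 0 1)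
      (Equiv.prodComm ι κ)
    convert! this using 1
  exact ((measurePreserving_curry_gaussPi κ ι).comp hs).comp
    ((measurePreserving_curry_gaussPi ι κ).symm)

/-- Row-wise version of `measurePreserving_split`. -/
lemma measurePreserving_split_rows (c : κ → ℝ) (hc : c ⬝ᵥ c = 1) :
    MeasurePreserving
      (fun (p : (ι → ℝ) × (ι → κ → ℝ)) i => p.1 i • c + (p.2 i - (c ⬝ᵥ p.2 i) • c))
      ((gaussPi ι).prod (Measure.pi fun _ : ι => gaussPi κ))
      (Measure.pi fun _ : ι => gaussPi κ) :=
  (measurePreserving_pi (fun _ : ι => (gaussianReal 0 1).prod (gaussPi κ))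
      (fun _ : ι => gaussPi κ) fun _ => measurePreserving_split c hc).comp
    (measurePreserving_arrowProdEquivProdArrow ℝ (κ → ℝ) ι (fun _ => gaussianReal 0 1)
      (fun _ => gaussPi κ)).symm

/-- Column-wise version of `measurePreserving_split`. -/
lemma measurePreserving_split_cols (b : ι → ℝ) (hb : b ⬝ᵥ b = 1) :
    MeasurePreserving
      (fun (p : (κ → ℝ) × (ι → κ → ℝ)) i => b i • p.1 + (p.2 i - b i • ∑ k, b k • p.2 k))
      ((gaussPi κ).prod (Measure.pi fun _ : ι => gaussPi κ))
      (Measure.pi fun _ : ι => gaussPi κ) := by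
  have := (measurePreserving_gaussPi_swap (ι := κ) (κ := ι)).comp
    ((measurePreserving_split_rows (ι := κ) b hb).comp
      ((MeasurePreserving.id (gaussPi κ)).prod (measurePreserving_gaussPi_swap (ι := ι) (κ := κ))))
  convert! this using 1
  ext p i j
  simp [dotProduct, Finset.sum_apply, mul_comm]

lemma map_sum_smul_gaussPi (y : ι → ℝ) (σ : ℝ) (hσ : σ ^ 2 = y ⬝ᵥ y) :
    (Measure.pi fun _ : ι => gaussPi κ).map (fun Z => ∑ i, y i • Z i)
      = (gaussPi κ).map (fun z => σ • z) := by
  have hm : Measurable fun z : ι → ℝ => y ⬝ᵥ z := by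
    simp only [dotProduct]; fun_prop
  have h1 : (fun Z : ι → κ → ℝ => ∑ i, y i • Z i)
      = (fun W : κ → ι → ℝ => fun j => y ⬝ᵥ W j) ∘ fun Z j i => Z i j := by
    ext Z j
    simp [dotProduct, Finset.sum_apply]
  rw [h1, ← Measure.map_map (by simp only [dotProduct]; fun_prop)
    measurePreserving_gaussPi_swap.measurable, measurePreserving_gaussPi_swap.map_eq]
  have := fun _ : κ => Measure.isProbabilityMeasure_map (μ := gaussPi ι) hm.aemeasurable
  have := fun _ : κ => Measure.isProbabilityMeasure_map (μ := gaussianReal 0 1)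
    (f := fun t => σ * t) (by fun_prop)
  rw [Measure.pi_map_pi (fun _ => hm.aemeasurable)]
  have h2 : (fun z : κ → ℝ => σ • z) = fun z j => (fun t => σ * t) (z j) := by
    ext z j; simp
  rw [h2, Measure.pi_map_pi (f := fun _ t => σ * t) (fun _ => by fun_prop)]
  simp_rw [map_dotProduct_gaussPi y σ hσ]

end Gaussian

section ProbFilter

variable {Ω Ω' : ℕ → Type*} [∀ n, MeasurableSpace (Ω n)] [∀ n, MeasurableSpace (Ω' n)]

/-- The filter of events of asymptotically full probability along a sequence of probability
spaces. A real function on the total space converges to `c` along it iff it converges to `c` in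
probability. -/
def probFilter (μ : ∀ n, Measure (Ω n)) : Filter (Σ n, Ω n) where
  sets := {A | Tendsto (fun n => μ n {ω | (⟨n, ω⟩ : Σ n, Ω n) ∉ A}) atTop (nhds 0)}
  univ_sets := by simp
  sets_of_superset {A B} hA hAB :=
    tendsto_of_tendsto_of_tendsto_of_le_of_le tendsto_const_nhds hA (fun _ => zero_le)
      fun _ => measure_mono fun _ hω h => hω (hAB h)
  inter_sets {A B} hA hB := by
    refine tendsto_of_tendsto_of_tendsto_of_le_of_le tendsto_const_nhds
      (by simpa using Tendsto.add hA hB) (fun _ => zero_le) fun n => ?_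
    refine (measure_mono ?_).trans (measure_union_le _ _)
    intro ω hω
    by_contra h
    simp only [Set.mem_union, Set.mem_ofPred_eq, not_or, not_not] at h
    exact hω h

variable {μ : ∀ n, Measure (Ω n)} {μ' : ∀ n, Measure (Ω' n)}

lemma mem_probFilter {A : Set (Σ n, Ω n)} :
    A ∈ probFilter μ ↔ Tendsto (fun n => μ n {ω | (⟨n, ω⟩ : Σ n, Ω n) ∉ A}) atTop (nhds 0) :=
  Iff.rfl

lemma tendsto_probFilter_iff {X : (Σ n, Ω n) → ℝ} {c : ℝ} :
    Tendsto X (probFilter μ) (nhds c) ↔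
      ∀ ε > 0, Tendsto (fun n => μ n {ω | ε ≤ |X ⟨n, ω⟩ - c|}) atTop (nhds 0) := by
  rw [Metric.tendsto_nhds]
  refine forall₂_congr fun ε _ => ?_
  change {p | dist (X p) c < ε} ∈ probFilter μ ↔ _
  simp only [mem_probFilter, Set.mem_ofPred_eq, not_lt, Real.dist_eq]

lemma tendsto_fst_probFilter : Tendsto Sigma.fst (probFilter μ) atTop := by
  rw [tendsto_atTop]
  intro m
  change {p : Σ n, Ω n | m ≤ p.1} ∈ probFilter μ
  rw [mem_probFilter]
  refine tendsto_const_nhds.congr' ?_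
  filter_upwards [eventually_ge_atTop m] with n hn
  simp [hn]

lemma eventually_probFilter_of_ae {P : (Σ n, Ω n) → Prop}
    (h : ∀ᶠ n in atTop, ∀ᵐ ω ∂μ n, P ⟨n, ω⟩) : ∀ᶠ p in probFilter μ, P p := by
  change {p | P p} ∈ probFilter μ
  rw [mem_probFilter]
  refine tendsto_const_nhds.congr' ?_
  filter_upwards [h] with n hn
  exact (ae_iff.1 hn).symm

lemma tendsto_probFilter_map {g : ∀ n, Ω n → Ω' n}
    (hg : ∀ n, MeasurePreserving (g n) (μ n) (μ' n)) :
    Tendsto (fun p : Σ n, Ω n => (⟨p.1, g p.1 p.2⟩ : Σ n, Ω' n)) (probFilter μ)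
      (probFilter μ') := by
  intro A hA
  rw [mem_map, mem_probFilter]
  rw [mem_probFilter] at hA
  refine tendsto_of_tendsto_of_tendsto_of_le_of_le tendsto_const_nhds hA (fun _ => zero_le)
    fun n => ?_
  have := Measure.le_map_apply (hg n).aemeasurable {ω | (⟨n, ω⟩ : Σ n, Ω' n) ∉ A}
  rwa [(hg n).map_eq] at this

lemma tendsto_zero_of_lintegral_sq {X : (Σ n, Ω n) → ℝ} {v : ℕ → ℝ}
    (hX : ∀ n, Measurable fun ω => X ⟨n, ω⟩)
    (h : ∀ n, ∫⁻ ω, ENNReal.ofReal (X ⟨n, ω⟩ ^ 2) ∂μ n ≤ ENNReal.ofReal (v n))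
    (hv : Tendsto v atTop (nhds 0)) : Tendsto X (probFilter μ) (nhds 0) := by
  rw [tendsto_probFilter_iff]
  intro ε hε
  have hε2 : ENNReal.ofReal (ε ^ 2) ≠ 0 := by simp [hε.ne']
  have hlim : Tendsto (fun n => ENNReal.ofReal (v n) / ENNReal.ofReal (ε ^ 2)) atTop (nhds 0) := by
    have := ENNReal.Tendsto.div_const (b := ENNReal.ofReal (ε ^ 2))
      (ENNReal.tendsto_ofReal hv) (Or.inr hε2)
    simpa using this
  refine tendsto_of_tendsto_of_tendsto_of_le_of_le tendsto_const_nhds hlim (fun _ => zero_le)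
    fun n => ?_
  have hs : {ω | ε ≤ |X ⟨n, ω⟩ - 0|}
      ⊆ {ω | ENNReal.ofReal (ε ^ 2) ≤ ENNReal.ofReal (X ⟨n, ω⟩ ^ 2)} := by
    intro ω hω
    refine ENNReal.ofReal_le_ofReal ?_
    rw [← sq_abs (X _)]
    have : ε ≤ |X ⟨n, ω⟩| := by simpa using hω
    gcongr
  refine (measure_mono hs).trans ((meas_ge_le_lintegral_div ?_ hε2 (by simp)).trans ?_)
  · exact ((hX n).pow_const 2).ennreal_ofReal.aemeasurable
  · gcongr
    exact h n

/-- Weak law of large numbers for triangular arrays with a fixed law `ν`. -/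
lemma tendsto_mean_pi {ν : Measure ℝ} [IsProbabilityMeasure ν] {f : ℝ → ℝ} (hf : Measurable f)
    (hf2 : MemLp f 2 ν) {k : ℕ → ℕ} (hk : Tendsto k atTop atTop) :
    Tendsto (fun p : Σ n, (Fin (k n) → ℝ) => (∑ i, f (p.2 i)) / k p.1)
      (probFilter fun n => Measure.pi fun _ : Fin (k n) => ν) (nhds (∫ x, f x ∂ν)) := by
  rw [tendsto_probFilter_iff]
  intro ε hε
  have hlim : Tendsto (fun n => ENNReal.ofReal (Var[f; ν] / ε ^ 2 / k n)) atTop (nhds 0) := by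
    have := ENNReal.tendsto_ofReal (Tendsto.const_div_atTop
      (tendsto_natCast_atTop_atTop.comp hk) (Var[f; ν] / ε ^ 2))
    simpa using this
  refine tendsto_of_tendsto_of_tendsto_of_le_of_le' tendsto_const_nhds hlim
    (Eventually.of_forall fun _ => zero_le) ?_
  filter_upwards [hk.eventually_gt_atTop 0] with n hn
  have hn' : (0 : ℝ) < k n := by exact_mod_cast hn
  have hmp (i : Fin (k n)) := measurePreserving_eval (fun _ : Fin (k n) => ν) i
  have hL (i : Fin (k n)) : MemLp (fun x : Fin (k n) → ℝ => f (x i)) 2 (Measure.pi fun _ => ν) :=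
    hf2.comp_measurePreserving (hmp i)
  have hS : MemLp (∑ i : Fin (k n), fun x : Fin (k n) → ℝ => f (x i)) 2
      (Measure.pi fun _ => ν) := memLp_finsetSum' _ fun i _ => hL i
  have hE : ∫ x, (∑ i : Fin (k n), fun x : Fin (k n) → ℝ => f (x i)) x ∂(Measure.pi fun _ => ν)
      = k n * ∫ x, f x ∂ν := by
    simp only [Finset.sum_apply]
    rw [integral_finsetSum _ fun i _ => (hL i).integrable one_le_two]
    have (i : Fin (k n)) : ∫ x : Fin (k n) → ℝ, f (x i) ∂(Measure.pi fun _ => ν)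
        = ∫ x, f x ∂ν := by
      conv_rhs => rw [← (hmp i).map_eq]
      rw [integral_map (hmp i).aemeasurable hf.aestronglyMeasurable]
    simp [this]
  have hV : Var[∑ i : Fin (k n), fun x : Fin (k n) → ℝ => f (x i); Measure.pi fun _ => ν]
      = k n * Var[f; ν] := by
    rw [variance_sum_pi (X := fun _ => f) fun _ => hf2]
    simp
  have := meas_ge_le_variance_div_sq hS (c := k n * ε) (by positivity)
  rw [hE, hV] at this
  refine (measure_mono fun x hx => ?_).trans (this.trans_eq ?_)
  · have hx' : ε ≤ |(∑ i, f (x i)) / k n - ∫ x, f x ∂ν| := hx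
    have he : (∑ i : Fin (k n), fun x : Fin (k n) → ℝ => f (x i)) x - k n * ∫ x, f x ∂ν
        = k n * ((∑ i, f (x i)) / k n - ∫ x, f x ∂ν) := by
      simp only [Finset.sum_apply]
      field_simp
    rw [Set.mem_ofPred_eq, he, abs_mul, abs_of_pos hn']
    gcongr
  · congr 1
    field_simp

lemma lintegral_dotProduct_sq {ι : Type*} [Fintype ι] (a : ι → ℝ) :
    ∫⁻ z, ENNReal.ofReal ((a ⬝ᵥ z) ^ 2) ∂gaussPi ι = ENNReal.ofReal (a ⬝ᵥ a) := by
  have hm : Measurable fun z : ι → ℝ => a ⬝ᵥ z := by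
    simp only [dotProduct]; fun_prop
  have h0 : 0 ≤ a ⬝ᵥ a := by
    simp only [dotProduct]; exact Finset.sum_nonneg fun i _ => mul_self_nonneg _
  have hσ := Real.sq_sqrt h0
  have h1 : ∫⁻ t, ENNReal.ofReal (t ^ 2) ∂gaussianReal 0 1 = 1 := by
    have := evariance_eq_lintegral_ofReal (fun t : ℝ => t) (gaussianReal 0 1)
    rw [← ofReal_variance (X := fun t : ℝ => t) (memLp_id_gaussianReal 2),
      variance_fun_id_gaussianReal] at this
    simpa using this.symm
  have h2 : ∫⁻ t, ENNReal.ofReal (t ^ 2) ∂((gaussPi ι).map (fun z => a ⬝ᵥ z))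
      = ENNReal.ofReal (a ⬝ᵥ a) := by
    rw [map_dotProduct_gaussPi a _ hσ, lintegral_map (by fun_prop) (by fun_prop)]
    simp_rw [mul_pow, hσ, ENNReal.ofReal_mul h0]
    rw [lintegral_const_mul _ (by fun_prop), h1, mul_one]
  rwa [lintegral_map (by fun_prop) hm] at h2

/-- The normalised inner product with an independent Gaussian vector tends to `0`. -/
lemma tendsto_dotProduct_div {k : ℕ → ℕ} [∀ n, SFinite (μ n)]
    {D : ∀ n, Ω n → Fin (k n) → ℝ} (hD : ∀ n, Measurable (D n)) {K : ℕ → ℝ}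
    (hK : ∀ n, ∫⁻ ω, ENNReal.ofReal (D n ω ⬝ᵥ D n ω) ∂μ n ≤ ENNReal.ofReal (K n))
    (hlim : Tendsto (fun n => K n / (n : ℝ) ^ 2) atTop (nhds 0)) :
    Tendsto (fun p : Σ n, Ω n × (Fin (k n) → ℝ) => D p.1 p.2.1 ⬝ᵥ p.2.2 / (p.1 : ℝ))
      (probFilter fun n => (μ n).prod (gaussPi (Fin (k n)))) (nhds 0) := by
  have hm (n : ℕ) : Measurable fun ω : Ω n × (Fin (k n) → ℝ) => D n ω.1 ⬝ᵥ ω.2 / (n : ℝ) := by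
    have := hD n
    simp only [dotProduct]; fun_prop
  refine tendsto_zero_of_lintegral_sq hm (fun n => ?_) hlim
  rw [lintegral_prod _ ((hm n).pow_const 2).ennreal_ofReal.aemeasurable]
  have (ω : Ω n) : ∫⁻ z, ENNReal.ofReal ((D n ω ⬝ᵥ z / (n : ℝ)) ^ 2) ∂gaussPi (Fin (k n))
      = ENNReal.ofReal (D n ω ⬝ᵥ D n ω / (n : ℝ) ^ 2) := by
    have h (z) : D n ω ⬝ᵥ z / (n : ℝ) = ((n : ℝ)⁻¹ • D n ω) ⬝ᵥ z := by
      simp [div_eq_inv_mul]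
    simp_rw [h]
    rw [lintegral_dotProduct_sq]
    congr 1
    simp only [smul_dotProduct, dotProduct_smul, smul_eq_mul]
    ring
  simp only [this]
  have hd : Measurable fun ω => ENNReal.ofReal (D n ω ⬝ᵥ D n ω) := by
    have := hD n
    simp only [dotProduct]; fun_prop
  simp_rw [div_eq_mul_inv, ENNReal.ofReal_mul' (inv_nonneg.2 (sq_nonneg (n : ℝ)))]
  rw [lintegral_mul_const _ hd]
  gcongr
  exact hK n

end ProbFilter

section Law

variable {ι κ : Type*} [Fintype ι] [Fintype κ]

/-- `XᵀX Xᵀ e` for the data matrix `X` with rows `x_μ = s_μ u + √Δ z_μ`. -/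
noncomputable def distill (Δ : ℝ) (u : κ → ℝ) (s e : ι → ℝ) (Z : ι → κ → ℝ) : κ → ℝ :=
  ∑ i, ((s i • u + √Δ • Z i) ⬝ᵥ ∑ j, e j • (s j • u + √Δ • Z j)) • (s i • u + √Δ • Z i)

/-- The direction of `p`, with the default value `u` when `p = 0`. -/
noncomputable def dir (u p : κ → ℝ) : κ → ℝ :=
  open Classical in if p = 0 then u else (√(p ⬝ᵥ p))⁻¹ • p

lemma sqrt_smul_dir (u p : κ → ℝ) : √(p ⬝ᵥ p) • dir u p = p := by
  by_cases h : p = 0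
  · simp [h]
  · have : √(p ⬝ᵥ p) ≠ 0 := by
      rw [Real.sqrt_ne_zero']
      exact lt_of_le_of_ne (Finset.sum_nonneg fun i _ => mul_self_nonneg _)
        fun h0 => h (dotProduct_self_eq_zero.1 h0.symm)
    simp [dir, h, smul_smul, this]

lemma dir_dotProduct_self (u p : κ → ℝ) (hu : u ⬝ᵥ u = 1) : dir u p ⬝ᵥ dir u p = 1 := by
  by_cases h : p = 0
  · simp [h, dir, hu]
  · have h0 : 0 ≤ p ⬝ᵥ p := Finset.sum_nonneg fun i _ => mul_self_nonneg _
    have h1 : p ⬝ᵥ p ≠ 0 := fun h0 => h (dotProduct_self_eq_zero.1 h0)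
    simp only [dir, h, if_false, smul_dotProduct, dotProduct_smul, smul_eq_mul]
    rw [← mul_assoc, ← mul_inv, Real.mul_self_sqrt h0, inv_mul_cancel₀ h1]

lemma measurable_dir (u : κ → ℝ) : Measurable (dir u) := by
  classical
  unfold dir
  refine Measurable.ite (measurableSet_singleton 0) measurable_const ?_
  simp only [dotProduct]; fun_prop

/-- The law of `Xᵀe`, given its Gaussian part `h`, where `e = σ b`. -/
noncomputable def redP (Δ σ : ℝ) (u : κ → ℝ) (s b : ι → ℝ) (h : κ → ℝ) : κ → ℝ :=
  (σ * (s ⬝ᵥ b)) • u + (√Δ * σ) • h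

/-- The law of `X p` given `p`. -/
noncomputable def redR (Δ : ℝ) (u : κ → ℝ) (s b : ι → ℝ) (h p : κ → ℝ) (h' : ι → ℝ) : ι → ℝ :=
  (u ⬝ᵥ p) • s + √Δ • ((h ⬝ᵥ p) • b + √(p ⬝ᵥ p) • (h' - (b ⬝ᵥ h') • b))

/-- `Xᵀ r` given `p`, `r` and the fresh noise `ζ`. -/
noncomputable def redW (Δ : ℝ) (u : κ → ℝ) (s b : ι → ℝ) (h c : κ → ℝ) (h' r : ι → ℝ)
    (ζ : κ → ℝ) : κ → ℝ :=
  (s ⬝ᵥ r) • u + √Δ • ((b ⬝ᵥ r) • h + ((r - (b ⬝ᵥ r) • b) ⬝ᵥ h') • c + (ζ - (c ⬝ᵥ ζ) • c))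

/-- A vector with the same law as `XᵀX Xᵀ e` built from three independent Gaussian vectors. -/
noncomputable def redDistill (Δ σ : ℝ) (u : κ → ℝ) (s b : ι → ℝ) (h : κ → ℝ) (h' : ι → ℝ)
    (h'' : κ → ℝ) : κ → ℝ :=
  let p := redP Δ σ u s b h
  let r := redR Δ u s b h p h'
  redW Δ u s b h (dir u p) h' r (√((r - (b ⬝ᵥ r) • b) ⬝ᵥ (r - (b ⬝ᵥ r) • b)) • h'')

lemma sum_smul_add_sub {ι κ : Type*} [Fintype ι] (y b : ι → ℝ) (h : κ → ℝ) (Z : ι → κ → ℝ) :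
    ∑ i, y i • (b i • h + (Z i - b i • ∑ k, b k • Z k))
      = (b ⬝ᵥ y) • h + ∑ i, (y - (b ⬝ᵥ y) • b) i • Z i := by
  have h1 : ∑ i, y i • b i • h = (b ⬝ᵥ y) • h := by
    simp_rw [smul_smul, ← Finset.sum_smul, dotProduct, mul_comm]
  have h2 : ∑ i, y i • b i • (∑ k, b k • Z k) = (b ⬝ᵥ y) • (∑ k, b k • Z k) := by
    simp_rw [smul_smul, ← Finset.sum_smul, dotProduct, mul_comm]
  simp only [smul_add, smul_sub, Finset.sum_add_distrib, Finset.sum_sub_distrib, h1, h2,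
    Pi.sub_apply, Pi.smul_apply, sub_smul, smul_eq_mul, mul_smul, ← Finset.smul_sum]

lemma sum_smul_split (y t : ι → ℝ) (c : κ → ℝ) (Z : ι → κ → ℝ) :
    ∑ i, y i • (t i • c + (Z i - (c ⬝ᵥ Z i) • c))
      = (y ⬝ᵥ t) • c + (∑ i, y i • Z i - (c ⬝ᵥ ∑ i, y i • Z i) • c) := by
  have h1 : ∑ i, y i • t i • c = (y ⬝ᵥ t) • c := by
    simp_rw [smul_smul, ← Finset.sum_smul, dotProduct]
  have h2 : ∑ i, y i • (c ⬝ᵥ Z i) • c = (c ⬝ᵥ ∑ i, y i • Z i) • c := by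
    simp_rw [smul_smul, ← Finset.sum_smul, dotProduct_sum, dotProduct_smul, smul_eq_mul]
  simp only [smul_add, smul_sub, Finset.sum_add_distrib, Finset.sum_sub_distrib, h1, h2]

lemma sum_smul_signal {ι κ : Type*} [Fintype ι] (Δ : ℝ) (u : κ → ℝ) (s y : ι → ℝ) (Z : ι → κ → ℝ) :
    ∑ i, y i • (s i • u + √Δ • Z i) = (s ⬝ᵥ y) • u + √Δ • ∑ i, y i • Z i := by
  have h1 : ∑ i, y i • s i • u = (s ⬝ᵥ y) • u := by
    simp_rw [smul_smul, ← Finset.sum_smul, dotProduct, mul_comm]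
  simp only [smul_add, Finset.sum_add_distrib, h1, Finset.smul_sum, smul_comm (y _) √Δ]

lemma distill_split (Δ σ : ℝ) (u : κ → ℝ) (hu : u ⬝ᵥ u = 1) (s b : ι → ℝ) (hb : b ⬝ᵥ b = 1)
    (h : κ → ℝ) (h' : ι → ℝ) (Z : ι → κ → ℝ) {p c : κ → ℝ} {r : ι → ℝ} {Z' : ι → κ → ℝ}
    (hp : p = redP Δ σ u s b h) (hc : c = dir u p) (hr : r = redR Δ u s b h p h')
    (hZ' : Z' = fun i => h' i • c + (Z i - (c ⬝ᵥ Z i) • c)) :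
    distill Δ u s (σ • b) (fun i => b i • h + (Z' i - b i • ∑ k, b k • Z' k))
      = redW Δ u s b h c h' r (∑ i, (r - (b ⬝ᵥ r) • b) i • Z i) := by
  have hcc : c ⬝ᵥ c = 1 := hc ▸ dir_dotProduct_self u p hu
  have hpc : √(p ⬝ᵥ p) • c = p := hc ▸ sqrt_smul_dir u p
  set Y : ι → κ → ℝ := fun i => b i • h + (Z' i - b i • ∑ k, b k • Z' k) with hY
  have e1 : ∑ i, b i • Y i = h := by
    rw [hY, sum_smul_add_sub, hb]; simp
  have e2 : ∑ j, (σ • b) j • (s j • u + √Δ • Y j) = p := by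
    have : ∑ i, (σ • b) i • Y i = σ • h := by
      rw [← e1]
      simp [Finset.smul_sum, smul_smul]
    rw [sum_smul_signal, this, hp, redP, dotProduct_smul, smul_smul, smul_eq_mul]
  have e3 (i) : Z' i ⬝ᵥ p = √(p ⬝ᵥ p) * h' i := by
    have : (h' i • c + (Z i - (c ⬝ᵥ Z i) • c)) ⬝ᵥ c = h' i := by
      simp only [add_dotProduct, sub_dotProduct, smul_dotProduct, hcc, dotProduct_comm (Z i) c]
      simp
    conv_lhs => rw [← hpc, hZ', dotProduct_smul]
    rw [this, smul_eq_mul]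
  have e4 (i) : (s i • u + √Δ • Y i) ⬝ᵥ p = r i := by
    have : (∑ k, b k • Z' k) ⬝ᵥ p = √(p ⬝ᵥ p) * (b ⬝ᵥ h') := by
      simp only [sum_dotProduct, smul_dotProduct, e3, smul_eq_mul]
      simp only [dotProduct, Finset.mul_sum]
      exact Finset.sum_congr rfl fun k _ => by ring
    simp only [hr, redR, hY, add_dotProduct, sub_dotProduct, smul_dotProduct, e3, this,
      Pi.add_apply, Pi.smul_apply, Pi.sub_apply, smul_eq_mul]
    ring
  unfold distill
  simp only [e2, e4]
  rw [sum_smul_signal, hY, sum_smul_add_sub, hZ', sum_smul_split, redW, add_assoc]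

lemma measurable_redDistill {Ω : Type*} [MeasurableSpace Ω] (Δ σ : ℝ) (u : κ → ℝ)
    {s b : Ω → ι → ℝ} {h h'' : Ω → κ → ℝ} {h' : Ω → ι → ℝ} (hs : Measurable s) (hb : Measurable b)
    (hh : Measurable h) (hh' : Measurable h') (hh'' : Measurable h'') :
    Measurable fun ω => redDistill Δ σ u (s ω) (b ω) (h ω) (h' ω) (h'' ω) := by
  have hp : Measurable fun ω => redP Δ σ u (s ω) (b ω) (h ω) := by
    simp only [redP, dotProduct]; fun_prop
  have hr : Measurable fun ω =>
      redR Δ u (s ω) (b ω) (h ω) (redP Δ σ u (s ω) (b ω) (h ω)) (h' ω) := by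
    simp only [redR, dotProduct]; fun_prop
  have hd := (measurable_dir u).comp hp
  simp only [Function.comp_def] at hd
  simp only [redDistill, redW, dotProduct] at hr ⊢
  fun_prop

lemma measure_distill_eq (Δ σ : ℝ) (u : κ → ℝ) (hu : u ⬝ᵥ u = 1) (s b : ι → ℝ)
    (hb : b ⬝ᵥ b = 1) {S : Set (κ → ℝ)} (hS : MeasurableSet S) :
    (Measure.pi fun _ : ι => gaussPi κ) {Z | distill Δ u s (σ • b) Z ∈ S}
      = ((gaussPi κ).prod ((gaussPi ι).prod (gaussPi κ)))
          {q | redDistill Δ σ u s b q.1 q.2.1 q.2.2 ∈ S} := by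
  have hdist : Measurable (distill Δ u s (σ • b)) := by
    unfold distill; simp only [dotProduct]; fun_prop
  have hA := measurePreserving_split_cols (κ := κ) b hb
  have hT : MeasurableSet {Z | distill Δ u s (σ • b) Z ∈ S} := hdist hS
  have hred : MeasurableSet {q : (κ → ℝ) × (ι → ℝ) × (κ → ℝ) |
      redDistill Δ σ u s b q.1 q.2.1 q.2.2 ∈ S} :=
    measurable_redDistill Δ σ u measurable_const measurable_const (by fun_prop)
      (by fun_prop) (by fun_prop) hS
  rw [← hA.measure_preimage hT.nullMeasurableSet, Measure.prod_apply (hA.measurable hT),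
    Measure.prod_apply hred]
  refine lintegral_congr fun h => ?_
  set p := redP Δ σ u s b h with hp
  set c := dir u p with hc
  have hB := measurePreserving_split_rows (ι := ι) c (dir_dotProduct_self u p hu)
  have hT1 := hA.measurable hT
  have hT2 := measurable_prodMk_left (x := h) hT1
  rw [← hB.measure_preimage hT2.nullMeasurableSet, Measure.prod_apply (hB.measurable hT2),
    Measure.prod_apply (measurable_prodMk_left hred)]
  refine lintegral_congr fun h' => ?_
  set r := redR Δ u s b h p h' with hr
  set y := r - (b ⬝ᵥ r) • b with hy
  have hW : Measurable (redW Δ u s b h c h' r) := by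
    unfold redW; simp only [dotProduct]; fun_prop
  have hl := map_sum_smul_gaussPi (κ := κ) y (√(y ⬝ᵥ y))
    (Real.sq_sqrt (Finset.sum_nonneg fun i _ => mul_self_nonneg _))
  have hWS : MeasurableSet {ζ | redW Δ u s b h c h' r ζ ∈ S} := hW hS
  have h1 := congrArg (fun m => m {ζ | redW Δ u s b h c h' r ζ ∈ S}) hl
  rw [Measure.map_apply (by fun_prop) hWS, Measure.map_apply (by fun_prop) hWS] at h1
  convert! h1 using 2
  ext Z
  have := distill_split Δ σ u hu s b hb h h' Z hp hc hr rfl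
  simp only [Set.mem_preimage, Set.mem_ofPred_eq]
  rw [← this]

end Law

section TestError

lemma Hfun_eq (x : ℝ) : Hfun x = (gaussianReal 0 1 (Set.Ioi x)).toReal := by
  rw [gaussianReal_apply_eq_integral _ one_ne_zero, ENNReal.toReal_ofReal
    (integral_nonneg fun t => gaussianPDFReal_nonneg _ _ _), Hfun]
  refine integral_congr_ae (Eventually.of_forall fun t => ?_)
  simp [gaussianPDFReal, div_eq_inv_mul]

lemma continuous_Hfun : Continuous Hfun := by
  have hdens : Integrable (fun t : ℝ => Real.exp (-t ^ 2 / 2) / √(2 * Real.pi)) := by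
    refine (integrable_gaussianPDFReal 0 1).congr (Eventually.of_forall fun t => ?_)
    simp [gaussianPDFReal, div_eq_inv_mul]
  have h (x : ℝ) : Hfun x = Hfun 0 - ∫ t in (0 : ℝ)..x, Real.exp (-t ^ 2 / 2) / √(2 * Real.pi) := by
    rw [Hfun, Hfun, ← intervalIntegral.integral_Ioi_sub_Ioi' hdens.integrableOn hdens.integrableOn]
    ring
  have h' : Hfun = fun x => Hfun 0 - ∫ t in (0 : ℝ)..x, Real.exp (-t ^ 2 / 2) / √(2 * Real.pi) :=
    funext h
  rw [h']
  exact continuous_const.sub (intervalIntegral.continuous_primitive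
    (fun a b => hdens.intervalIntegrable) 0)

lemma measurable_realSign : Measurable Real.sign := by
  unfold Real.sign
  exact Measurable.ite measurableSet_Iio measurable_const
    (Measurable.ite measurableSet_Ioi measurable_const measurable_const)

lemma sign_ne_one_iff (x : ℝ) : Real.sign x ≠ 1 ↔ x ≤ 0 := by
  rcases lt_trichotomy x 0 with h | h | h
  · simp [Real.sign_of_neg h, h.le]; norm_num
  · simp [h]
  · simp [Real.sign_of_pos h, h]

lemma sign_ne_neg_one_iff (x : ℝ) : Real.sign x ≠ -1 ↔ 0 ≤ x := by
  rcases lt_trichotomy x 0 with h | h | h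
  · simp [Real.sign_of_neg h, h]
  · simp [h]
  · simp [Real.sign_of_pos h, h.le]; norm_num

lemma gaussianReal_Iic_neg (x : ℝ) :
    gaussianReal 0 1 (Set.Iic (-x)) = gaussianReal 0 1 (Set.Ioi x) := by
  have h := gaussianReal_map_neg (μ := 0) (v := 1)
  rw [neg_zero] at h
  conv_lhs => rw [← h]
  have := nullSingletonClass_gaussianReal (μ := 0) (v := 1) one_ne_zero
  rw [Measure.map_apply measurable_neg measurableSet_Iic, ← measure_congr Ioi_ae_eq_Ici.symm]
  congr 1
  ext t
  simp

/-- The direction of the class means. -/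
noncomputable def meanDir (N : ℕ) : Fin N → ℝ := fun _ => 1 / √N

lemma meanDir_dotProduct_self {N : ℕ} (hN : 0 < N) : meanDir N ⬝ᵥ meanDir N = 1 := by
  have : (0 : ℝ) < N := by exact_mod_cast hN
  simp [dotProduct, meanDir, ← mul_inv, this.ne']

lemma genErr_eq {N : ℕ} {Δ : ℝ} (hΔ : 0 < Δ) {w : Fin N → ℝ} (hw : 0 < w ⬝ᵥ w) :
    genErr N Δ w = Hfun ((meanDir N ⬝ᵥ w) / √(Δ * (w ⬝ᵥ w))) := by
  set σ := √(w ⬝ᵥ w) with hσ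
  have hσ0 : 0 < σ := Real.sqrt_pos.2 hw
  have hσ2 : σ ^ 2 = w ⬝ᵥ w := Real.sq_sqrt hw.le
  have hd : 0 < √Δ := Real.sqrt_pos.2 hΔ
  set m := meanDir N ⬝ᵥ w with hm
  rw [Real.sqrt_mul hΔ.le, ← hσ]
  set x := m / (√Δ * σ) with hx
  have hmeas : MeasurableSet
      {p : (Fin N → ℝ) × ℝ | Real.sign (∑ i, w i * p.1 i) ≠ 2 * p.2 - 1} := by
    refine (measurableSet_eq_fun (measurable_realSign.comp ?_) ?_).compl <;> fun_prop
  have hmap : Measurable fun p : ℝ × (Fin N → ℝ) =>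
      ((fun i => (2 * p.1 - 1) * 1 / √N + √Δ * p.2 i, p.1) : (Fin N → ℝ) × ℝ) := by fun_prop
  have hsum (y : ℝ) (z : Fin N → ℝ) :
      ∑ i, w i * ((2 * y - 1) * 1 / √N + √Δ * z i) = (2 * y - 1) * m + √Δ * (w ⬝ᵥ z) := by
    simp only [hm, dotProduct, meanDir, Finset.mul_sum, ← Finset.sum_add_distrib]
    exact Finset.sum_congr rfl fun i _ => by ring
  have hg {B : Set ℝ} (hB : MeasurableSet B) : stdGaussianVec N {z | w ⬝ᵥ z ∈ B}
      = gaussianReal 0 1 {t | σ * t ∈ B} := by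
    have h := congrArg (fun ν => ν B) (map_dotProduct_gaussPi w σ hσ2)
    rwa [Measure.map_apply (by simp only [dotProduct]; fun_prop) hB,
      Measure.map_apply (by fun_prop) hB] at h
  have h1 : stdGaussianVec N {z | m + √Δ * (w ⬝ᵥ z) ≤ 0} = gaussianReal 0 1 (Set.Ioi x) := by
    have := hg (B := {r | m + √Δ * r ≤ 0}) (measurableSet_le (by fun_prop) (by fun_prop))
    refine this.trans ?_
    rw [← gaussianReal_Iic_neg]
    congr 1
    ext t
    simp only [Set.mem_ofPred_eq, Set.mem_Iic, hx, ← neg_div]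
    rw [le_div_iff₀ (by positivity)]
    constructor <;> intro h <;> linarith
  have h2 : stdGaussianVec N {z | 0 ≤ -m + √Δ * (w ⬝ᵥ z)} = gaussianReal 0 1 (Set.Ioi x) := by
    have := hg (B := {r | 0 ≤ -m + √Δ * r}) (measurableSet_le (by fun_prop) (by fun_prop))
    refine this.trans ?_
    have := nullSingletonClass_gaussianReal (μ := 0) (v := 1) one_ne_zero
    rw [measure_congr Ioi_ae_eq_Ici]
    congr 1
    ext t
    simp only [Set.mem_ofPred_eq, Set.mem_Ici, hx]
    rw [div_le_iff₀ (by positivity)]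
    constructor <;> intro h <;> linarith
  have : SFinite (stdGaussianVec N) := by unfold stdGaussianVec; infer_instance
  have hb : SFinite (bern (1 / 2)) := by unfold bern; infer_instance
  rw [genErr, testMeasure, Measure.map_apply hmap hmeas, Measure.prod_apply (hmap hmeas), Hfun_eq]
  congr 1
  conv_lhs => rw [bern]
  rw [lintegral_add_measure, lintegral_smul_measure, lintegral_smul_measure, lintegral_dirac,
    lintegral_dirac]
  simp only [Set.preimage_ofPred_eq, hsum]
  have e1 : {z : Fin N → ℝ | Real.sign ((2 * 1 - 1) * m + √Δ * (w ⬝ᵥ z)) ≠ 2 * (1 : ℝ) - 1}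
      = {z | m + √Δ * (w ⬝ᵥ z) ≤ 0} := by
    ext z
    have := sign_ne_one_iff (m + √Δ * (w ⬝ᵥ z))
    norm_num at this ⊢
    exact this
  have e2 : {z : Fin N → ℝ | Real.sign ((2 * 0 - 1) * m + √Δ * (w ⬝ᵥ z)) ≠ 2 * (0 : ℝ) - 1}
      = {z | 0 ≤ -m + √Δ * (w ⬝ᵥ z)} := by
    ext z
    have := sign_ne_neg_one_iff (-m + √Δ * (w ⬝ᵥ z))
    norm_num at this ⊢
    exact this
  rw [e1, e2, h1, h2, smul_eq_mul, smul_eq_mul, ← add_mul, ← ENNReal.ofReal_add] <;> norm_num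

end TestError

section Reduced

lemma tendsto_nhds_congr {T X : Type*} [TopologicalSpace X] {l : Filter T} {f : T → X} {x y : X}
    (h : Tendsto f l (nhds x)) (hxy : x = y) : Tendsto f l (nhds y) := hxy ▸ h

lemma redDistill_dotProducts {ι κ : Type*} [Fintype ι] [Fintype κ] {Δ q a S A B τ ρ C A' G B' : ℝ}
    {u h h'' : κ → ℝ} {s b h' : ι → ℝ} (hq : 0 < q) (ha : 0 < a)
    (huu : u ⬝ᵥ u = 1) (hbb : b ⬝ᵥ b = 1) (hss : s ⬝ᵥ s = q ^ 2 * a ^ 2)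
    (hsb : s ⬝ᵥ b = q * a * S) (huh : u ⬝ᵥ h = q * A) (hhh : h ⬝ᵥ h = q ^ 2 * B)
    (hsh : s ⬝ᵥ h' = q ^ 2 * τ) (hbh : b ⬝ᵥ h' = q * ρ / a) (hh'h' : h' ⬝ᵥ h' = q ^ 2 * C)
    (huh'' : u ⬝ᵥ h'' = q * A') (hhh'' : h ⬝ᵥ h'' = q ^ 2 * G) (hh''h'' : h'' ⬝ᵥ h'' = q ^ 2 * B')
    {d U E R C₁ C₂ C₃ C₄ K : ℝ} (hd : d = √Δ) (hU : U = a ^ 2 * S + d * a * A)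
    (hE : E = a ^ 2 * S * A + d * a * B) (hR : R = √(a ^ 2 * S * U + d * a * E)) (hR0 : 0 < R)
    (hC₁ : C₁ = a ^ 2 * U + d * (a * S * E + R * (τ - S * ρ)))
    (hC₂ : C₂ = a * S * U + d * E)
    (hC₃ : C₃ = U * (τ - S * ρ) + d * R * (C - ρ ^ 2 / a ^ 2))
    (hC₄ : C₄ = √(U ^ 2 * (a ^ 2 - a ^ 2 * S ^ 2) + 2 * U * d * R * (τ - S * ρ)
      + d ^ 2 * R ^ 2 * (C - ρ ^ 2 / a ^ 2)))
    (hK : K = a ^ 2 * S * A' + d * a * G) :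
    u ⬝ᵥ redDistill Δ (q * a) u s b h h' h''
      = q ^ 4 * (C₁ + d * (C₂ * A + C₃ * (U / R) + C₄ * (A' - K / R * (U / R)))) ∧
    redDistill Δ (q * a) u s b h h' h'' ⬝ᵥ redDistill Δ (q * a) u s b h h' h''
      = q ^ 8 * (C₁ ^ 2 + d ^ 2 * (C₂ ^ 2 * B + C₃ ^ 2 + C₄ ^ 2 * (B' - (K / R) ^ 2))
        + 2 * d * C₁ * (C₂ * A + C₃ * (U / R) + C₄ * (A' - K / R * (U / R)))
        + 2 * d ^ 2 * (C₂ * C₃ * (E / R) + C₂ * C₄ * (G - K / R * (E / R)))) := by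
  have hbs : b ⬝ᵥ s = q * a * S := by rw [dotProduct_comm, hsb]
  have hhu : h ⬝ᵥ u = q * A := by rw [dotProduct_comm, huh]
  have hh's : h' ⬝ᵥ s = q ^ 2 * τ := by rw [dotProduct_comm, hsh]
  have hh'b : h' ⬝ᵥ b = q * ρ / a := by rw [dotProduct_comm, hbh]
  have hh''u : h'' ⬝ᵥ u = q * A' := by rw [dotProduct_comm, huh'']
  have hh''h : h'' ⬝ᵥ h = q ^ 2 * G := by rw [dotProduct_comm, hhh'']
  obtain ⟨p, hp⟩ : ∃ p, p = redP Δ (q * a) u s b h := ⟨_, rfl⟩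
  have hp' : p = (q ^ 2 * a ^ 2 * S) • u + (d * q * a) • h := by
    rw [hp, redP, hsb, ← hd]; congr 2 <;> ring
  have hup : u ⬝ᵥ p = q ^ 2 * U := by
    simp only [hp', dotProduct_add, dotProduct_smul, huu, huh, smul_eq_mul, hU]; ring
  have hhp : h ⬝ᵥ p = q ^ 3 * E := by
    simp only [hp', dotProduct_add, dotProduct_smul, hhu, hhh, smul_eq_mul, hE]; ring
  have hh''p : h'' ⬝ᵥ p = q ^ 3 * K := by
    simp only [hp', dotProduct_add, dotProduct_smul, hh''u, hh''h, smul_eq_mul, hK]; ring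
  have hpp : √(p ⬝ᵥ p) = q ^ 2 * R := by
    have : p ⬝ᵥ p = (q ^ 2) ^ 2 * (a ^ 2 * S * U + d * a * E) := by
      nth_rw 1 [hp']
      simp only [add_dotProduct, smul_dotProduct, hup, hhp, smul_eq_mul]; ring
    rw [this, Real.sqrt_mul (by positivity), Real.sqrt_sq (by positivity), hR]
  obtain ⟨c, hc⟩ : ∃ c, c = dir u p := ⟨_, rfl⟩
  have hcc : c ⬝ᵥ c = 1 := hc ▸ dir_dotProduct_self u p huu
  have hpc : (q ^ 2 * R) • c = p := by rw [← hpp, hc]; exact sqrt_smul_dir u p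
  have hdiv {x v : ℝ} (hx : q ^ 2 * R * x = v) : x = v / (q ^ 2 * R) := by
    rw [← hx]; field_simp
  have huc : u ⬝ᵥ c = U / R := by
    rw [← hpc, dotProduct_smul, smul_eq_mul] at hup
    rw [hdiv hup]; field_simp
  have hhc : h ⬝ᵥ c = q * (E / R) := by
    rw [← hpc, dotProduct_smul, smul_eq_mul] at hhp
    rw [hdiv hhp]; field_simp
  have hh''c : h'' ⬝ᵥ c = q * (K / R) := by
    rw [← hpc, dotProduct_smul, smul_eq_mul] at hh''p
    rw [hdiv hh''p]; field_simp
  have hcu : c ⬝ᵥ u = U / R := by rw [dotProduct_comm, huc]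
  have hch : c ⬝ᵥ h = q * (E / R) := by rw [dotProduct_comm, hhc]
  have hch'' : c ⬝ᵥ h'' = q * (K / R) := by rw [dotProduct_comm, hh''c]
  obtain ⟨r, hr⟩ : ∃ r, r = redR Δ u s b h p h' := ⟨_, rfl⟩
  have hr' : r = (q ^ 2 * U) • s +
      d • ((q ^ 3 * E) • b + (q ^ 2 * R) • (h' - (q * ρ / a) • b)) := by
    rw [hr, redR, hup, hhp, hpp, hbh, hd]
  have hsr : s ⬝ᵥ r = q ^ 4 * C₁ := by
    simp only [hr', dotProduct_add, dotProduct_smul, dotProduct_sub, hss, hsb, hsh, smul_eq_mul,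
      hC₁]
    field_simp
  have hbr : b ⬝ᵥ r = q ^ 3 * C₂ := by
    simp only [hr', dotProduct_add, dotProduct_smul, dotProduct_sub, hbs, hbb, hbh, smul_eq_mul,
      hC₂]
    ring
  obtain ⟨y, hy⟩ : ∃ y, y = r - (b ⬝ᵥ r) • b := ⟨_, rfl⟩
  have hy' : y = (q ^ 2 * U) • (s - (q * a * S) • b) +
      (d * q ^ 2 * R) • (h' - (q * ρ / a) • b) := by
    rw [hy, hbr, hr', hC₂]
    ext i
    simp only [Pi.add_apply, Pi.sub_apply, Pi.smul_apply, smul_eq_mul]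
    ring
  have hyh : y ⬝ᵥ h' = q ^ 4 * C₃ := by
    simp only [hy', add_dotProduct, smul_dotProduct, sub_dotProduct, hsh, hbh, hh'h', smul_eq_mul,
      hC₃]
    field_simp
  have hyy : √(y ⬝ᵥ y) = q ^ 3 * C₄ := by
    have : y ⬝ᵥ y = (q ^ 3) ^ 2 * (U ^ 2 * (a ^ 2 - a ^ 2 * S ^ 2) + 2 * U * d * R * (τ - S * ρ)
        + d ^ 2 * R ^ 2 * (C - ρ ^ 2 / a ^ 2)) := by
      simp only [hy', add_dotProduct, smul_dotProduct, sub_dotProduct, dotProduct_add,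
        dotProduct_smul, dotProduct_sub, hss, hsb, hbs, hbb, hsh, hh's, hbh, hh'b, hh'h',
        smul_eq_mul]
      field_simp
      ring
    rw [this, Real.sqrt_mul (by positivity), Real.sqrt_sq (by positivity), hC₄]
  have hw : redDistill Δ (q * a) u s b h h' h''
      = (q ^ 4 * C₁) • u + d • ((q ^ 3 * C₂) • h + (q ^ 4 * C₃) • c
        + ((q ^ 3 * C₄) • h'' - (q ^ 4 * C₄ * (K / R)) • c)) := by
    have hw₀ : redDistill Δ (q * a) u s b h h' h''
        = redW Δ u s b h c h' r (√(y ⬝ᵥ y) • h'') := by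
      rw [hy, hc, hr, hp]; rfl
    have hcoef : q ^ 3 * C₄ * (q * (K / R)) = q ^ 4 * C₄ * (K / R) := by ring
    rw [hw₀, redW, ← hy, hsr, hyh, hyy, hbr, dotProduct_smul, hch'', ← hd, smul_eq_mul, hcoef]
  rw [hw]
  constructor
  · simp only [dotProduct_add, dotProduct_smul, dotProduct_sub, huu, huh, huc, huh'', smul_eq_mul]
    ring
  · simp only [add_dotProduct, smul_dotProduct, sub_dotProduct, dotProduct_add,
      dotProduct_smul, dotProduct_sub, huu, huh, huc, huh'', hhu, hhh, hhc, hhh'', hcu, hch, hcc,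
      hch'', hh''u, hh''h, hh''c, hh''h'', smul_eq_mul]
    ring

/-- Continuity of the scalar functionals in `redDistill_dotProducts` at the limiting values. -/
lemma tendsto_redDistill_scalars {T : Type*} {l : Filter T} {Δ α k : ℝ} (hΔ : 0 < Δ) (hα : 0 < α)
    {a S A B τ ρ C A' G B' : T → ℝ} (ha : Tendsto a l (nhds √α)) (hS : Tendsto S l (nhds k))
    (hA : Tendsto A l (nhds 0)) (hB : Tendsto B l (nhds 1)) (hτ : Tendsto τ l (nhds 0))
    (hρ : Tendsto ρ l (nhds 0)) (hC : Tendsto C l (nhds α)) (hA' : Tendsto A' l (nhds 0))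
    (hG : Tendsto G l (nhds 0)) (hB' : Tendsto B' l (nhds 1))
    {d : ℝ} {U E R C₁ C₂ C₃ C₄ K m Q : T → ℝ} (hd : d = √Δ)
    (hU : ∀ t, U t = a t ^ 2 * S t + d * a t * A t)
    (hE : ∀ t, E t = a t ^ 2 * S t * A t + d * a t * B t)
    (hR : ∀ t, R t = √(a t ^ 2 * S t * U t + d * a t * E t))
    (hC₁ : ∀ t, C₁ t = a t ^ 2 * U t + d * (a t * S t * E t + R t * (τ t - S t * ρ t)))
    (hC₂ : ∀ t, C₂ t = a t * S t * U t + d * E t)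
    (hC₃ : ∀ t, C₃ t = U t * (τ t - S t * ρ t) + d * R t * (C t - ρ t ^ 2 / a t ^ 2))
    (hC₄ : ∀ t, C₄ t = √(U t ^ 2 * (a t ^ 2 - a t ^ 2 * S t ^ 2)
      + 2 * U t * d * R t * (τ t - S t * ρ t) + d ^ 2 * R t ^ 2 * (C t - ρ t ^ 2 / a t ^ 2)))
    (hK : ∀ t, K t = a t ^ 2 * S t * A' t + d * a t * G t)
    (hm : ∀ t, m t = C₁ t + d * (C₂ t * A t + C₃ t * (U t / R t)
      + C₄ t * (A' t - K t / R t * (U t / R t))))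
    (hQ : ∀ t, Q t = C₁ t ^ 2
      + d ^ 2 * (C₂ t ^ 2 * B t + C₃ t ^ 2 + C₄ t ^ 2 * (B' t - (K t / R t) ^ 2))
      + 2 * d * C₁ t * (C₂ t * A t + C₃ t * (U t / R t)
        + C₄ t * (A' t - K t / R t * (U t / R t)))
      + 2 * d ^ 2 * (C₂ t * C₃ t * (E t / R t) + C₂ t * C₄ t * (G t - K t / R t * (E t / R t))))
    (hk : k ^ 2 ≤ 1) :
    (∀ᶠ t in l, 0 < R t) ∧ Tendsto m l (nhds (α * (Δ + α + Δ * α) * k)) ∧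
      Tendsto Q l (nhds ((α ^ 2 + 3 * α + 1) * Δ ^ 3 * α
        + α ^ 2 * (Δ ^ 2 * (α ^ 2 + 5 * α + 3) + Δ * (2 * α + 3) * α + α ^ 2) * k ^ 2)) := by
  have hd2 : d ^ 2 = Δ := by rw [hd, Real.sq_sqrt hΔ.le]
  have hd0 : 0 < d := hd ▸ Real.sqrt_pos.2 hΔ
  obtain ⟨x, hx⟩ : ∃ x, x = √α := ⟨_, rfl⟩
  have hx2 : x ^ 2 = α := by rw [hx, Real.sq_sqrt hα.le]
  have hx0 : 0 < x := hx ▸ Real.sqrt_pos.2 hα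
  rw [← hx] at ha
  have tU : Tendsto U l (nhds (x ^ 2 * k)) := by
    rw [funext hU]
    have := ((ha.pow 2).mul hS).add ((ha.const_mul d).mul hA)
    simpa using this
  have tE : Tendsto E l (nhds (d * x)) := by
    rw [funext hE]
    have := (((ha.pow 2).mul hS).mul hA).add ((ha.const_mul d).mul hB)
    simpa using this
  obtain ⟨y, hy⟩ : ∃ y, y = √(x ^ 4 * k ^ 2 + d ^ 2 * x ^ 2) := ⟨_, rfl⟩
  have hy0 : 0 < y := hy ▸ Real.sqrt_pos.2 (by positivity)
  have hy2 : y ^ 2 = x ^ 4 * k ^ 2 + d ^ 2 * x ^ 2 := by rw [hy, Real.sq_sqrt (by positivity)]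
  have tR : Tendsto R l (nhds y) := by
    rw [funext hR, hy]
    have := ((((ha.pow 2).mul hS).mul tU).add ((ha.const_mul d).mul tE)).sqrt
    convert! this using 3
    ring
  have t1 : Tendsto (fun t => τ t - S t * ρ t) l (nhds 0) := by
    simpa using hτ.sub (hS.mul hρ)
  have t2 : Tendsto (fun t => C t - ρ t ^ 2 / a t ^ 2) l (nhds (x ^ 2)) := by
    have := hC.sub ((hρ.pow 2).div (ha.pow 2) (by positivity))
    simpa [hx2] using this
  have tC₁ : Tendsto C₁ l (nhds (x ^ 2 * (x ^ 2 * k) + d * (x * k * (d * x)))) := by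
    rw [funext hC₁]
    have := ((ha.pow 2).mul tU).add ((((ha.mul hS).mul tE).add (tR.mul t1)).const_mul d)
    simpa using this
  have tC₂ : Tendsto C₂ l (nhds (x * k * (x ^ 2 * k) + d * (d * x))) := by
    rw [funext hC₂]
    exact ((ha.mul hS).mul tU).add (tE.const_mul d)
  have tC₃ : Tendsto C₃ l (nhds (d * y * x ^ 2)) := by
    rw [funext hC₃]
    have := (tU.mul t1).add ((tR.const_mul d).mul t2)
    simpa using this
  have tC₄ : Tendsto C₄ l (nhds √((x ^ 2 * k) ^ 2 * (x ^ 2 - x ^ 2 * k ^ 2)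
      + d ^ 2 * y ^ 2 * x ^ 2)) := by
    rw [funext hC₄]
    have := ((((tU.pow 2).mul ((ha.pow 2).sub ((ha.pow 2).mul (hS.pow 2)))).add
      ((((tU.const_mul 2).mul_const d).mul tR).mul t1)).add
      (((tR.pow 2).const_mul (d ^ 2)).mul t2)).sqrt
    simpa using this
  obtain ⟨z, hz⟩ : ∃ z, z = √((x ^ 2 * k) ^ 2 * (x ^ 2 - x ^ 2 * k ^ 2)
      + d ^ 2 * y ^ 2 * x ^ 2) := ⟨_, rfl⟩
  have hz2 : z ^ 2 = (x ^ 2 * k) ^ 2 * (x ^ 2 - x ^ 2 * k ^ 2) + d ^ 2 * y ^ 2 * x ^ 2 := by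
    have h1 : 0 ≤ x ^ 2 - x ^ 2 * k ^ 2 := by nlinarith [sq_nonneg x]
    rw [hz, Real.sq_sqrt (by positivity)]
  rw [← hz] at tC₄
  have tK : Tendsto K l (nhds 0) := by
    rw [funext hK]
    have := (((ha.pow 2).mul hS).mul hA').add ((ha.const_mul d).mul hG)
    simpa using this
  have tKR : Tendsto (fun t => K t / R t) l (nhds 0) := by
    have := tK.div tR hy0.ne'
    rw [zero_div] at this
    exact this
  have tUR := tU.div tR hy0.ne'
  have tER := tE.div tR hy0.ne'
  have tin := ((tC₂.mul hA).add (tC₃.mul tUR)).add (tC₄.mul (hA'.sub (tKR.mul tUR)))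
  refine ⟨tR.eventually (lt_mem_nhds hy0), ?_, ?_⟩
  · rw [funext hm]
    refine tendsto_nhds_congr (tC₁.add (tin.const_mul d)) ?_
    rw [← hx2, ← hd2]
    field_simp
    ring
  · rw [funext hQ]
    have := (((tC₁.pow 2).add (((((tC₂.pow 2).mul hB).add (tC₃.pow 2)).add
      ((tC₄.pow 2).mul (hB'.sub (tKR.pow 2)))).const_mul (d ^ 2))).add
      ((tC₁.const_mul (2 * d)).mul tin)).add
      ((((tC₂.mul tC₃).mul tER).add ((tC₂.mul tC₄).mul (hG.sub (tKR.mul tER)))).const_mul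
        (2 * d ^ 2))
    refine tendsto_nhds_congr this ?_
    have e1 : d * y * x ^ 2 * (x ^ 2 * k / y) = d * x ^ 2 * (x ^ 2 * k) := by field_simp
    have e2 : (x * k * (x ^ 2 * k) + d * (d * x)) * (d * y * x ^ 2) * (d * x / y)
        = (x * k * (x ^ 2 * k) + d * (d * x)) * (d * x ^ 2) * (d * x) := by field_simp
    rw [e1, e2, hz2, mul_pow (d * y), mul_pow d y, hy2, ← hx2, ← hd2]
    ring

end Reduced

section Labels

lemma isProbabilityMeasure_bern {p : ℝ} (h0 : 0 ≤ p) (h1 : p ≤ 1) :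
    IsProbabilityMeasure (bern p) := by
  refine ⟨?_⟩
  simp [bern, ← ENNReal.ofReal_add h0 (sub_nonneg.2 h1)]

lemma ae_bern (p : ℝ) : ∀ᵐ x ∂bern p, x = 0 ∨ x = 1 := by
  rw [ae_iff, bern]
  simp

lemma ae_pi_bern {ι : Type*} [Fintype ι] {p : ℝ} [IsProbabilityMeasure (bern p)] :
    ∀ᵐ y ∂(Measure.pi fun _ : ι => bern p), ∀ i, y i = 0 ∨ y i = 1 :=
  eventually_all.2 fun i =>
    (measurePreserving_eval (fun _ : ι => bern p) i).quasiMeasurePreserving.ae (ae_bern p)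

lemma integral_bern {p : ℝ} (h0 : 0 ≤ p) (h1 : p ≤ 1) (f : ℝ → ℝ) :
    ∫ x, f x ∂bern p = p * f 1 + (1 - p) * f 0 := by
  rw [bern, integral_add_measure, integral_smul_measure, integral_smul_measure]
  · simp [ENNReal.toReal_ofReal h0, ENNReal.toReal_ofReal (sub_nonneg.2 h1)]
  · exact (integrable_dirac (by simp)).smul_measure ENNReal.ofReal_ne_top
  · exact (integrable_dirac (by simp)).smul_measure ENNReal.ofReal_ne_top

variable {ι : Type*}

/-- The signs `2 * y - 1` of the labels `y`. -/
def labelSign (y : ι → ℝ) : ι → ℝ := fun i => 2 * y i - 1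

/-- The signs of the noisy labels. -/
noncomputable def noisySign (l : (ι → ℝ) × (ι → ℝ)) : ι → ℝ :=
  fun i => 2 * (if l.2 i = 1 then 1 - l.1 i else l.1 i) - 1

/-- The sign change caused by a flip indicator. -/
noncomputable def flipSign (x : ℝ) : ℝ := if x = 1 then -1 else 1

lemma measurable_labelSign : Measurable (labelSign (ι := ι)) := by
  unfold labelSign; fun_prop

lemma measurable_noisySign : Measurable (noisySign (ι := ι)) := by
  refine measurable_pi_lambda _ fun i => ((Measurable.ite ?_ ?_ ?_).const_mul 2).sub_const 1
  · exact measurableSet_eq_fun (by fun_prop) measurable_const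
  · fun_prop
  · fun_prop

lemma measurable_flipSign : Measurable flipSign :=
  Measurable.ite (measurableSet_singleton 1) measurable_const measurable_const

variable [Fintype ι]

lemma labelSign_dotProduct_self {y : ι → ℝ} (hy : ∀ i, y i = 0 ∨ y i = 1) :
    labelSign y ⬝ᵥ labelSign y = Fintype.card ι := by
  have this (i : ι) : labelSign y i * labelSign y i = 1 := by
    rcases hy i with h | h <;> simp [labelSign, h]; norm_num
  simp [dotProduct, this]

lemma noisySign_dotProduct_self {l : (ι → ℝ) × (ι → ℝ)} (hy : ∀ i, l.1 i = 0 ∨ l.1 i = 1) :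
    noisySign l ⬝ᵥ noisySign l = Fintype.card ι := by
  have this (i : ι) : noisySign l i * noisySign l i = 1 := by
    rcases hy i with h | h <;> by_cases h' : l.2 i = 1 <;> simp [noisySign, h, h'] <;> norm_num
  simp [dotProduct, this]

lemma labelSign_dotProduct_noisySign {l : (ι → ℝ) × (ι → ℝ)}
    (hy : ∀ i, l.1 i = 0 ∨ l.1 i = 1) :
    labelSign l.1 ⬝ᵥ noisySign l = ∑ i, flipSign (l.2 i) := by
  refine Finset.sum_congr rfl fun i _ => ?_
  rcases hy i with h | h <;> by_cases h' : l.2 i = 1 <;>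
    simp [labelSign, noisySign, flipSign, h, h'] <;> norm_num

end Labels

section Limits

/-- The law of the true labels and the flip indicators. -/
noncomputable abbrev labelMeasure (M : ℕ) (θ : ℝ) : Measure ((Fin M → ℝ) × (Fin M → ℝ)) :=
  (Measure.pi fun _ => bern (1 / 2)).prod (Measure.pi fun _ => bern θ)

/-- Labels together with the three Gaussian vectors which drive `redDistill`. -/
abbrev RedSpace (N M : ℕ) :=
  ((Fin M → ℝ) × (Fin M → ℝ)) × (Fin N → ℝ) × (Fin M → ℝ) × (Fin N → ℝ)

/-- The law on `RedSpace`. -/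
noncomputable abbrev redMeasure (N M : ℕ) (θ : ℝ) : Measure (RedSpace N M) :=
  (labelMeasure M θ).prod
    ((gaussPi (Fin N)).prod ((gaussPi (Fin M)).prod (gaussPi (Fin N))))

/-- The reduced version of `XᵀX Xᵀ e`, as a random vector on `RedSpace`. -/
noncomputable def redVec {N M : ℕ} (Δ : ℝ) (ω : RedSpace N M) : Fin N → ℝ :=
  redDistill Δ √M (meanDir N) (labelSign ω.1.1) ((√M)⁻¹ • noisySign ω.1) ω.2.1 ω.2.2.1 ω.2.2.2

lemma measurable_redVec {N M : ℕ} (Δ : ℝ) : Measurable (redVec (N := N) (M := M) Δ) :=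
  measurable_redDistill Δ _ _ (measurable_labelSign.comp (measurable_fst.comp measurable_fst))
    ((measurable_noisySign.comp measurable_fst).const_smul (√(M : ℝ))⁻¹) (by fun_prop) (by fun_prop)
    (by fun_prop)

lemma integral_sq_gaussianReal : ∫ t, t ^ 2 ∂gaussianReal 0 1 = 1 := by
  have h := variance_fun_id_gaussianReal (μ := 0) (v := 1)
  rw [variance_of_integral_eq_zero (by fun_prop) (by simp)] at h
  simpa using h

lemma memLp_sq_gaussianReal : MemLp (fun t : ℝ => t ^ 2) 2 (gaussianReal 0 1) := by
  refine (memLp_two_iff_integrable_sq (by fun_prop)).2 ?_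
  have := (memLp_id_gaussianReal (μ := 0) (v := 1) 4).integrable_norm_pow (by norm_num)
  refine this.congr (Eventually.of_forall fun t => ?_)
  simp only [id, Real.norm_eq_abs, ← pow_mul]
  exact Even.pow_abs (by decide) t

lemma tendsto_sum_gaussPi {k : ℕ → ℕ} (hk : Tendsto k atTop atTop) :
    Tendsto (fun p : Σ n, Fin (k n) → ℝ => (∑ i, p.2 i) / (k p.1 : ℝ))
      (probFilter fun n => gaussPi (Fin (k n))) (nhds 0) := by
  have := tendsto_mean_pi (ν := gaussianReal 0 1) (f := fun t => t) measurable_id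
    (memLp_id_gaussianReal 2) hk
  simpa using this

lemma tendsto_sq_gaussPi {k : ℕ → ℕ} (hk : Tendsto k atTop atTop) :
    Tendsto (fun p : Σ n, Fin (k n) → ℝ => (p.2 ⬝ᵥ p.2) / (k p.1 : ℝ))
      (probFilter fun n => gaussPi (Fin (k n))) (nhds 1) := by
  have := tendsto_mean_pi (ν := gaussianReal 0 1) (f := fun t => t ^ 2) (by fun_prop)
    memLp_sq_gaussianReal hk
  rw [integral_sq_gaussianReal] at this
  simpa only [dotProduct, pow_two] using this

lemma lintegral_dotProduct_self_gaussPi {ι : Type*} [Fintype ι] :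
    ∫⁻ z, ENNReal.ofReal (z ⬝ᵥ z) ∂gaussPi ι = ENNReal.ofReal (Fintype.card ι) := by
  classical
  have h (z : ι → ℝ) : ENNReal.ofReal (z ⬝ᵥ z)
      = ∑ i, ENNReal.ofReal ((Pi.single i 1 ⬝ᵥ z) ^ 2) := by
    rw [← ENNReal.ofReal_sum_of_nonneg fun i _ => sq_nonneg _]
    simp only [single_one_dotProduct, pow_two]
    rfl
  simp_rw [h]
  rw [lintegral_finsetSum _ fun i _ => by simp only [dotProduct]; fun_prop]
  simp_rw [lintegral_dotProduct_sq]
  simp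

lemma tendsto_ceil_mul {α : ℝ} (hα : 0 < α) :
    Tendsto (fun n : ℕ => ⌈α * n⌉₊) atTop atTop :=
  tendsto_nat_ceil_atTop.comp (tendsto_natCast_atTop_atTop.const_mul_atTop hα)

lemma tendsto_ceil_mul_div {α : ℝ} (hα : 0 ≤ α) :
    Tendsto (fun n : ℕ => (⌈α * n⌉₊ : ℝ) / n) atTop (nhds α) :=
  (tendsto_nat_ceil_mul_div_atTop hα).comp tendsto_natCast_atTop_atTop

end Limits

section Reduction

section Projections

variable {θ : ℝ} [IsProbabilityMeasure (bern (1 / 2))] [IsProbabilityMeasure (bern θ)]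

lemma tendsto_flips_probFilter (k : ℕ → ℕ) :
    Tendsto (fun p : Σ N, RedSpace N (k N) => (⟨p.1, p.2.1.2⟩ : Σ N, Fin (k N) → ℝ))
      (probFilter fun N => redMeasure N (k N) θ)
      (probFilter fun N => Measure.pi fun _ : Fin (k N) => bern θ) :=
  tendsto_probFilter_map (Ω := fun N => RedSpace N (k N)) (Ω' := fun N => Fin (k N) → ℝ)
    (μ := fun N => redMeasure N (k N) θ) (μ' := fun N => Measure.pi fun _ : Fin (k N) => bern θ)
    (g := fun _ ω => ω.1.2) fun _ =>
    measurePreserving_snd.comp measurePreserving_fst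

lemma tendsto_first_probFilter (k : ℕ → ℕ) :
    Tendsto (fun p : Σ N, RedSpace N (k N) => (⟨p.1, p.2.2.1⟩ : Σ N, Fin N → ℝ))
      (probFilter fun N => redMeasure N (k N) θ)
      (probFilter fun N => gaussPi (Fin N)) :=
  tendsto_probFilter_map (Ω := fun N => RedSpace N (k N)) (Ω' := fun N => Fin N → ℝ)
    (μ := fun N => redMeasure N (k N) θ) (μ' := fun N => gaussPi (Fin N))
    (g := fun _ ω => ω.2.1) fun _ =>
    measurePreserving_fst.comp measurePreserving_snd

lemma tendsto_second_probFilter (k : ℕ → ℕ) :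
    Tendsto (fun p : Σ N, RedSpace N (k N) => (⟨p.1, p.2.2.2.1⟩ : Σ N, Fin (k N) → ℝ))
      (probFilter fun N => redMeasure N (k N) θ)
      (probFilter fun N => gaussPi (Fin (k N))) :=
  tendsto_probFilter_map (Ω := fun N => RedSpace N (k N)) (Ω' := fun N => Fin (k N) → ℝ)
    (μ := fun N => redMeasure N (k N) θ) (μ' := fun N => gaussPi (Fin (k N)))
    (g := fun _ ω => ω.2.2.1) fun _ =>
    measurePreserving_fst.comp (measurePreserving_snd.comp measurePreserving_snd)

lemma tendsto_third_probFilter (k : ℕ → ℕ) :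
    Tendsto (fun p : Σ N, RedSpace N (k N) => (⟨p.1, p.2.2.2.2⟩ : Σ N, Fin N → ℝ))
      (probFilter fun N => redMeasure N (k N) θ)
      (probFilter fun N => gaussPi (Fin N)) :=
  tendsto_probFilter_map (Ω := fun N => RedSpace N (k N)) (Ω' := fun N => Fin N → ℝ)
    (μ := fun N => redMeasure N (k N) θ) (μ' := fun N => gaussPi (Fin N))
    (g := fun _ ω => ω.2.2.2) fun _ =>
    measurePreserving_snd.comp (measurePreserving_snd.comp measurePreserving_snd)

lemma tendsto_labels_second_probFilter (k : ℕ → ℕ) :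
    Tendsto (fun p : Σ N, RedSpace N (k N) => (⟨p.1, (p.2.1, p.2.2.2.1)⟩ :
      Σ N, ((Fin (k N) → ℝ) × (Fin (k N) → ℝ)) × (Fin (k N) → ℝ)))
      (probFilter fun N => redMeasure N (k N) θ)
      (probFilter fun N => (labelMeasure (k N) θ).prod (gaussPi (Fin (k N)))) :=
  tendsto_probFilter_map (Ω := fun N => RedSpace N (k N))
    (Ω' := fun N => ((Fin (k N) → ℝ) × (Fin (k N) → ℝ)) × (Fin (k N) → ℝ))
    (μ := fun N => redMeasure N (k N) θ)
    (μ' := fun N => (labelMeasure (k N) θ).prod (gaussPi (Fin (k N))))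
    (g := fun _ ω => (ω.1, ω.2.2.1)) fun _ =>
    (MeasurePreserving.id _).prod (measurePreserving_fst.comp measurePreserving_snd)

lemma tendsto_first_third_probFilter (k : ℕ → ℕ) :
    Tendsto (fun p : Σ N, RedSpace N (k N) => (⟨p.1, (p.2.2.1, p.2.2.2.2)⟩ :
      Σ N, (Fin N → ℝ) × (Fin N → ℝ)))
      (probFilter fun N => redMeasure N (k N) θ)
      (probFilter fun N => (gaussPi (Fin N)).prod (gaussPi (Fin N))) :=
  tendsto_probFilter_map (Ω := fun N => RedSpace N (k N))
    (Ω' := fun N => (Fin N → ℝ) × (Fin N → ℝ))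
    (μ := fun N => redMeasure N (k N) θ)
    (μ' := fun N => (gaussPi (Fin N)).prod (gaussPi (Fin N)))
    (g := fun _ ω => (ω.2.1, ω.2.2.2)) fun _ =>
    ((MeasurePreserving.id _).prod measurePreserving_snd).comp measurePreserving_snd

lemma eventually_labels (k : ℕ → ℕ) : ∀ᶠ p : Σ N, RedSpace N (k N) in
    probFilter (fun N => redMeasure N (k N) θ), ∀ i, p.2.1.1 i = 0 ∨ p.2.1.1 i = 1 :=
  eventually_probFilter_of_ae (Ω := fun N => RedSpace N (k N))
    (P := fun p : Σ N, RedSpace N (k N) => ∀ i, p.2.1.1 i = 0 ∨ p.2.1.1 i = 1)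
    (Eventually.of_forall fun N => (MeasurePreserving.quasiMeasurePreserving
      (f := fun ω : RedSpace N (k N) => ω.1.1)
      (measurePreserving_fst.comp measurePreserving_fst)).ae ae_pi_bern)

end Projections

lemma tendsto_redVec {Δ α θ : ℝ} (hΔ : 0 < Δ) (hα : 0 < α) (hθ0 : 0 ≤ θ) (hθ : θ < 1 / 2)
    {k : ℕ → ℕ} (hk : Tendsto k atTop atTop)
    (hkd : Tendsto (fun N => (k N : ℝ) / N) atTop (nhds α)) :
    Tendsto (fun p : Σ N, RedSpace N (k N) => (meanDir p.1 ⬝ᵥ redVec Δ p.2) / (p.1 : ℝ) ^ 2)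
      (probFilter fun N => redMeasure N (k N) θ)
      (nhds (α * (Δ + α + Δ * α) * (1 - 2 * θ))) ∧
    Tendsto (fun p : Σ N, RedSpace N (k N) => (redVec Δ p.2 ⬝ᵥ redVec Δ p.2) / (p.1 : ℝ) ^ 4)
      (probFilter fun N => redMeasure N (k N) θ)
      (nhds ((α ^ 2 + 3 * α + 1) * Δ ^ 3 * α
        + α ^ 2 * (Δ ^ 2 * (α ^ 2 + 5 * α + 3) + Δ * (2 * α + 3) * α + α ^ 2)
          * (1 - 2 * θ) ^ 2)) := by
  have := isProbabilityMeasure_bern (p := 1 / 2) (by norm_num) (by norm_num)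
  have := isProbabilityMeasure_bern hθ0 (by linarith)
  have hfst := tendsto_fst_probFilter (μ := fun N => redMeasure N (k N) θ)
  have hlabel := eventually_labels (θ := θ) k
  have hh := tendsto_first_probFilter (θ := θ) k
  have hh' := tendsto_second_probFilter (θ := θ) k
  have hh'' := tendsto_third_probFilter (θ := θ) k
  have hLG := tendsto_labels_second_probFilter (θ := θ) k
  have hGG := tendsto_first_third_probFilter (θ := θ) k
  have hf := tendsto_flips_probFilter (θ := θ) k
  generalize probFilter (fun N => redMeasure N (k N) θ) = l at *
  have ha : Tendsto (fun p : Σ N, RedSpace N (k N) => √((k p.1 : ℝ) / p.1)) l (nhds √α) :=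
    (hkd.comp hfst).sqrt
  have hS : Tendsto (fun p : Σ N, RedSpace N (k N) =>
      (labelSign p.2.1.1 ⬝ᵥ noisySign p.2.1) / (k p.1 : ℝ)) l (nhds (1 - 2 * θ)) := by
    have hb : MemLp flipSign 2 (bern θ) :=
      MemLp.of_bound measurable_flipSign.aestronglyMeasurable 1 (Eventually.of_forall fun x => by
        by_cases h : x = 1 <;> simp [flipSign, h])
    have h1 := (tendsto_mean_pi measurable_flipSign hb hk).comp hf
    have h2 : ∫ x, flipSign x ∂bern θ = 1 - 2 * θ := by
      rw [integral_bern hθ0 (by linarith)]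
      simp [flipSign]; ring
    rw [h2] at h1
    refine h1.congr' ?_
    filter_upwards [hlabel] with p hp
    rw [labelSign_dotProduct_noisySign hp]
    rfl
  have hA := (tendsto_sum_gaussPi tendsto_id).comp hh
  have hB := (tendsto_sq_gaussPi tendsto_id).comp hh
  have hA' := (tendsto_sum_gaussPi tendsto_id).comp hh''
  have hB' := (tendsto_sq_gaussPi tendsto_id).comp hh''
  have hC : Tendsto (fun p : Σ N, RedSpace N (k N) => (p.2.2.2.1 ⬝ᵥ p.2.2.2.1) / (p.1 : ℝ)) l
      (nhds α) := by
    have := ((tendsto_sq_gaussPi hk).comp hh').mul (hkd.comp hfst)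
    rw [one_mul] at this
    refine this.congr' ?_
    filter_upwards [hfst.eventually (hk.eventually_gt_atTop 0)] with p hp
    have : (0 : ℝ) < k p.1 := by exact_mod_cast hp
    simp only [Function.comp_apply]
    field_simp
  have hk2 : Tendsto (fun N : ℕ => (k N : ℝ) / (N : ℝ) ^ 2) atTop (nhds 0) := by
    have := hkd.mul (tendsto_inv_atTop_nhds_zero_nat (𝕜 := ℝ))
    rw [mul_zero] at this
    refine this.congr fun N => ?_
    rw [pow_two, div_mul_eq_div_mul_one_div, div_eq_mul_inv 1, one_mul]
  have hlab (N : ℕ) : ∀ᵐ ω ∂labelMeasure (k N) θ, ∀ i, ω.1 i = 0 ∨ ω.1 i = 1 :=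
    measurePreserving_fst.quasiMeasurePreserving.ae ae_pi_bern
  have hτ : Tendsto (fun p : Σ N, RedSpace N (k N) =>
      (labelSign p.2.1.1 ⬝ᵥ p.2.2.2.1) / (p.1 : ℝ)) l (nhds 0) := by
    have h := tendsto_dotProduct_div (k := k) (K := fun N => k N)
      (Ω := fun N => (Fin (k N) → ℝ) × (Fin (k N) → ℝ)) (μ := fun N => labelMeasure (k N) θ)
      (D := fun N ω => labelSign ω.1) (fun N => measurable_labelSign.comp measurable_fst)
      (fun N => by
        rw [lintegral_congr_ae ((hlab N).mono fun ω hω => by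
          rw [labelSign_dotProduct_self hω])]
        simp) hk2
    have h' := h.comp hLG
    simp only [Function.comp_def] at h'
    exact h'
  have hρ : Tendsto (fun p : Σ N, RedSpace N (k N) =>
      (noisySign p.2.1 ⬝ᵥ p.2.2.2.1) / (p.1 : ℝ)) l (nhds 0) := by
    have h := tendsto_dotProduct_div (k := k) (K := fun N => k N)
      (Ω := fun N => (Fin (k N) → ℝ) × (Fin (k N) → ℝ)) (μ := fun N => labelMeasure (k N) θ)
      (D := fun N ω => noisySign ω) (fun N => measurable_noisySign) (fun N => by
        rw [lintegral_congr_ae ((hlab N).mono fun ω hω => by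
          rw [noisySign_dotProduct_self hω])]
        simp) hk2
    have h' := h.comp hLG
    simp only [Function.comp_def] at h'
    exact h'
  have hG : Tendsto (fun p : Σ N, RedSpace N (k N) =>
      (p.2.2.1 ⬝ᵥ p.2.2.2.2) / (p.1 : ℝ)) l (nhds 0) := by
    have hinv : Tendsto (fun N : ℕ => (N : ℝ) / (N : ℝ) ^ 2) atTop (nhds 0) := by
      refine (tendsto_inv_atTop_nhds_zero_nat (𝕜 := ℝ)).congr fun N => ?_
      by_cases h : (N : ℝ) = 0
      · simp [h]
      · field_simp
    have h := tendsto_dotProduct_div (k := fun N => N) (K := fun N => N)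
      (Ω := fun N => Fin N → ℝ) (μ := fun N => gaussPi (Fin N))
      (D := fun N h => h) (fun N => measurable_id)
      (fun N => by rw [lintegral_dotProduct_self_gaussPi, Fintype.card_fin]) hinv
    have h' := h.comp hGG
    simp only [Function.comp_def] at h'
    exact h'
  let T := Σ N, RedSpace N (k N)
  obtain ⟨a, ea⟩ : ∃ f : T → ℝ, ∀ p, f p = √((k p.1 : ℝ) / p.1) := ⟨_, fun _ => rfl⟩
  obtain ⟨S, eS⟩ : ∃ f : T → ℝ, ∀ p, f p = (labelSign p.2.1.1 ⬝ᵥ noisySign p.2.1) / (k p.1 : ℝ) :=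
    ⟨_, fun _ => rfl⟩
  obtain ⟨A, eA⟩ : ∃ f : T → ℝ, ∀ p, f p = (∑ i, p.2.2.1 i) / (p.1 : ℝ) := ⟨_, fun _ => rfl⟩
  obtain ⟨B, eB⟩ : ∃ f : T → ℝ, ∀ p, f p = (p.2.2.1 ⬝ᵥ p.2.2.1) / (p.1 : ℝ) := ⟨_, fun _ => rfl⟩
  obtain ⟨τ, eτ⟩ : ∃ f : T → ℝ, ∀ p, f p = (labelSign p.2.1.1 ⬝ᵥ p.2.2.2.1) / (p.1 : ℝ) :=
    ⟨_, fun _ => rfl⟩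
  obtain ⟨ρ, eρ⟩ : ∃ f : T → ℝ, ∀ p, f p = (noisySign p.2.1 ⬝ᵥ p.2.2.2.1) / (p.1 : ℝ) :=
    ⟨_, fun _ => rfl⟩
  obtain ⟨C, eC⟩ : ∃ f : T → ℝ, ∀ p, f p = (p.2.2.2.1 ⬝ᵥ p.2.2.2.1) / (p.1 : ℝ) :=
    ⟨_, fun _ => rfl⟩
  obtain ⟨A', eA'⟩ : ∃ f : T → ℝ, ∀ p, f p = (∑ i, p.2.2.2.2 i) / (p.1 : ℝ) := ⟨_, fun _ => rfl⟩
  obtain ⟨G, eG⟩ : ∃ f : T → ℝ, ∀ p, f p = (p.2.2.1 ⬝ᵥ p.2.2.2.2) / (p.1 : ℝ) := ⟨_, fun _ => rfl⟩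
  obtain ⟨B', eB'⟩ : ∃ f : T → ℝ, ∀ p, f p = (p.2.2.2.2 ⬝ᵥ p.2.2.2.2) / (p.1 : ℝ) :=
    ⟨_, fun _ => rfl⟩
  have ha := ha.congr fun p => (ea p).symm
  have hS := hS.congr fun p => (eS p).symm
  have hA : Tendsto A l (nhds 0) := hA.congr fun p => (eA p).symm
  have hB : Tendsto B l (nhds 1) := hB.congr fun p => (eB p).symm
  have hτ := hτ.congr fun p => (eτ p).symm
  have hρ := hρ.congr fun p => (eρ p).symm
  have hC := hC.congr fun p => (eC p).symm
  have hA' : Tendsto A' l (nhds 0) := hA'.congr fun p => (eA' p).symm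
  have hG := hG.congr fun p => (eG p).symm
  have hB' : Tendsto B' l (nhds 1) := hB'.congr fun p => (eB' p).symm
  obtain ⟨d, hd⟩ : ∃ d, d = √Δ := ⟨_, rfl⟩
  obtain ⟨U, hU⟩ : ∃ U : T → ℝ, ∀ t, U t = a t ^ 2 * S t + d * a t * A t := ⟨_, fun _ => rfl⟩
  obtain ⟨E, hE⟩ : ∃ E : T → ℝ, ∀ t, E t = a t ^ 2 * S t * A t + d * a t * B t :=
    ⟨_, fun _ => rfl⟩
  obtain ⟨R, hR⟩ : ∃ R : T → ℝ, ∀ t, R t = √(a t ^ 2 * S t * U t + d * a t * E t) :=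
    ⟨_, fun _ => rfl⟩
  obtain ⟨C₁, hC₁⟩ : ∃ C₁ : T → ℝ, ∀ t,
      C₁ t = a t ^ 2 * U t + d * (a t * S t * E t + R t * (τ t - S t * ρ t)) := ⟨_, fun _ => rfl⟩
  obtain ⟨C₂, hC₂⟩ : ∃ C₂ : T → ℝ, ∀ t, C₂ t = a t * S t * U t + d * E t := ⟨_, fun _ => rfl⟩
  obtain ⟨C₃, hC₃⟩ : ∃ C₃ : T → ℝ, ∀ t,
      C₃ t = U t * (τ t - S t * ρ t) + d * R t * (C t - ρ t ^ 2 / a t ^ 2) := ⟨_, fun _ => rfl⟩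
  obtain ⟨C₄, hC₄⟩ : ∃ C₄ : T → ℝ, ∀ t, C₄ t = √(U t ^ 2 * (a t ^ 2 - a t ^ 2 * S t ^ 2)
      + 2 * U t * d * R t * (τ t - S t * ρ t) + d ^ 2 * R t ^ 2 * (C t - ρ t ^ 2 / a t ^ 2)) :=
    ⟨_, fun _ => rfl⟩
  obtain ⟨K, hK⟩ : ∃ K : T → ℝ, ∀ t, K t = a t ^ 2 * S t * A' t + d * a t * G t :=
    ⟨_, fun _ => rfl⟩
  obtain ⟨m, hm'⟩ : ∃ m : T → ℝ, ∀ t, m t = C₁ t + d * (C₂ t * A t + C₃ t * (U t / R t)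
      + C₄ t * (A' t - K t / R t * (U t / R t))) := ⟨_, fun _ => rfl⟩
  obtain ⟨Q, hQ'⟩ : ∃ Q : T → ℝ, ∀ t, Q t = C₁ t ^ 2
      + d ^ 2 * (C₂ t ^ 2 * B t + C₃ t ^ 2 + C₄ t ^ 2 * (B' t - (K t / R t) ^ 2))
      + 2 * d * C₁ t * (C₂ t * A t + C₃ t * (U t / R t)
        + C₄ t * (A' t - K t / R t * (U t / R t)))
      + 2 * d ^ 2 * (C₂ t * C₃ t * (E t / R t) + C₂ t * C₄ t * (G t - K t / R t * (E t / R t))) :=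
    ⟨_, fun _ => rfl⟩
  obtain ⟨hR0, hm, hQ⟩ := tendsto_redDistill_scalars hΔ hα ha hS hA hB hτ hρ hC hA' hG hB' hd
    hU hE hR hC₁ hC₂ hC₃ hC₄ hK hm' hQ' (by nlinarith)
  have key : ∀ᶠ p : T in l, 0 < (p.1 : ℝ) ∧
      meanDir p.1 ⬝ᵥ redVec Δ p.2 = (p.1 : ℝ) ^ 2 * m p ∧
      redVec Δ p.2 ⬝ᵥ redVec Δ p.2 = (p.1 : ℝ) ^ 4 * Q p := by
    filter_upwards [hR0, hlabel, hfst.eventually (hk.eventually_gt_atTop 0),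
      hfst.eventually (eventually_gt_atTop 0)] with p hRp hp hM hN
    have hN' : (0 : ℝ) < p.1 := by exact_mod_cast hN
    have hM' : (0 : ℝ) < k p.1 := by exact_mod_cast hM
    have hN2 : √(p.1 : ℝ) ^ 2 = p.1 := Real.sq_sqrt hN'.le
    have hM2 : √(k p.1 : ℝ) ^ 2 = k p.1 := Real.sq_sqrt hM'.le
    have hsN : 0 < √(p.1 : ℝ) := Real.sqrt_pos.2 hN'
    have hsM : 0 < √(k p.1 : ℝ) := Real.sqrt_pos.2 hM'
    have hap : 0 < a p := ea p ▸ Real.sqrt_pos.2 (by positivity)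
    have hqa : √(p.1 : ℝ) * a p = √(k p.1 : ℝ) := by
      rw [ea, ← Real.sqrt_mul hN'.le]; congr 1; field_simp
    have hq (x y : ℝ) (h : y = x / p.1) : x = √(p.1 : ℝ) ^ 2 * y := by
      rw [hN2, h, mul_div_cancel₀ _ hN'.ne']
    have hu (z : Fin p.1 → ℝ) (x : ℝ) (h : x = (∑ i, z i) / p.1) :
        meanDir p.1 ⬝ᵥ z = √(p.1 : ℝ) * x := by
      have : meanDir p.1 ⬝ᵥ z = 1 / √(p.1 : ℝ) * ∑ i, z i := by
        simp only [dotProduct, meanDir, ← Finset.mul_sum]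
      rw [this, hq _ _ h]
      field_simp
    have hbb : ((√(k p.1 : ℝ))⁻¹ • noisySign p.2.1) ⬝ᵥ ((√(k p.1 : ℝ))⁻¹ • noisySign p.2.1)
        = 1 := by
      rw [smul_dotProduct, dotProduct_smul, noisySign_dotProduct_self hp, Fintype.card_fin,
        smul_smul, ← mul_inv, Real.mul_self_sqrt hM'.le, smul_eq_mul, inv_mul_cancel₀ hM'.ne']
    have hss : labelSign p.2.1.1 ⬝ᵥ labelSign p.2.1.1 = √(p.1 : ℝ) ^ 2 * a p ^ 2 := by
      rw [labelSign_dotProduct_self hp, ← mul_pow, hqa, hM2, Fintype.card_fin]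
    have hsb : labelSign p.2.1.1 ⬝ᵥ ((√(k p.1 : ℝ))⁻¹ • noisySign p.2.1)
        = √(p.1 : ℝ) * a p * S p := by
      have : labelSign p.2.1.1 ⬝ᵥ noisySign p.2.1 = √(k p.1 : ℝ) ^ 2 * S p := by
        rw [hM2, eS, mul_div_cancel₀ _ hM'.ne']
      rw [hqa, dotProduct_smul, smul_eq_mul, this]
      field_simp
    have hbh : ((√(k p.1 : ℝ))⁻¹ • noisySign p.2.1) ⬝ᵥ p.2.2.2.1
        = √(p.1 : ℝ) * ρ p / a p := by
      rw [smul_dotProduct, smul_eq_mul, hq _ _ (eρ p), ← hqa]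
      field_simp
    have := redDistill_dotProducts hsN hap (meanDir_dotProduct_self hN) hbb hss hsb
      (hu _ _ (eA p)) (hq _ _ (eB p)) (hq _ _ (eτ p)) hbh (hq _ _ (eC p)) (hu _ _ (eA' p))
      (hq _ _ (eG p)) (hq _ _ (eB' p)) hd (hU p) (hE p) (hR p) hRp (hC₁ p) (hC₂ p) (hC₃ p)
      (hC₄ p) (hK p)
    have h4 : √(p.1 : ℝ) ^ 4 = (p.1 : ℝ) ^ 2 := by rw [pow_mul _ 2 2, hN2]
    have h8 : √(p.1 : ℝ) ^ 8 = (p.1 : ℝ) ^ 4 := by rw [pow_mul _ 2 4, hN2]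
    rw [hqa, h4, h8, ← hm', ← hQ'] at this
    exact ⟨hN', this.1, this.2⟩
  refine ⟨hm.congr' ?_, hQ.congr' ?_⟩
  · filter_upwards [key] with p hp
    exact eq_div_of_mul_eq (pow_pos hp.1 2).ne' (by rw [hp.2.1, mul_comm])
  · filter_upwards [key] with p hp
    exact eq_div_of_mul_eq (pow_pos hp.1 4).ne' (by rw [hp.2.2, mul_comm])

end Reduction

section Transfer

lemma trainMeasure_distill_eq {N M : ℕ} {Δ θ : ℝ} (hN : 0 < N) (hM : 0 < M)
    [IsProbabilityMeasure (bern (1 / 2))] [IsProbabilityMeasure (bern θ)]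
    {S : Set (Fin N → ℝ)} (hS : MeasurableSet S) :
    trainMeasure N M θ
        {ω | distill Δ (meanDir N) (labelSign ω.1) (noisySign (ω.1, ω.2.1)) ω.2.2 ∈ S}
      = redMeasure N M θ {ω | redVec Δ ω ∈ S} := by
  have hdist : Measurable fun ω : ((Fin M → ℝ) × (Fin M → ℝ)) × (Fin M → Fin N → ℝ) =>
      distill Δ (meanDir N) (labelSign ω.1.1) (noisySign ω.1) ω.2 := by
    have h1 : Measurable fun ω : ((Fin M → ℝ) × (Fin M → ℝ)) × (Fin M → Fin N → ℝ) =>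
        labelSign ω.1.1 := measurable_labelSign.comp (measurable_fst.comp measurable_fst)
    have h2 : Measurable fun ω : ((Fin M → ℝ) × (Fin M → ℝ)) × (Fin M → Fin N → ℝ) =>
        noisySign ω.1 := measurable_noisySign.comp measurable_fst
    unfold distill
    simp only [dotProduct]
    fun_prop
  have hassoc : MeasurePreserving MeasurableEquiv.prodAssoc
      ((labelMeasure M θ).prod (Measure.pi fun _ : Fin M => gaussPi (Fin N)))
      (trainMeasure N M θ) :=
    measurePreserving_prodAssoc _ _ _
  rw [← hassoc.measure_preimage_equiv]
  have hpre : MeasurableEquiv.prodAssoc ⁻¹'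
      {ω : TrainSpace N M |
        distill Δ (meanDir N) (labelSign ω.1) (noisySign (ω.1, ω.2.1)) ω.2.2 ∈ S}
      = {ω | distill Δ (meanDir N) (labelSign ω.1.1) (noisySign ω.1) ω.2 ∈ S} := rfl
  rw [hpre]
  refine (Measure.prod_apply (hdist hS)).trans (.trans ?_
    (Measure.prod_apply (measurable_redVec Δ hS)).symm)
  have hlab : ∀ᵐ ω ∂labelMeasure M θ, ∀ i, ω.1 i = 0 ∨ ω.1 i = 1 :=
    measurePreserving_fst.quasiMeasurePreserving.ae ae_pi_bern
  refine lintegral_congr_ae (hlab.mono fun ω hω => ?_)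
  have hM' : (0 : ℝ) < M := by exact_mod_cast hM
  have hM0 : √(M : ℝ) ≠ 0 := (Real.sqrt_pos.2 hM').ne'
  have hb : ((√(M : ℝ))⁻¹ • noisySign ω) ⬝ᵥ ((√(M : ℝ))⁻¹ • noisySign ω) = 1 := by
    rw [smul_dotProduct, dotProduct_smul, noisySign_dotProduct_self hω, Fintype.card_fin,
      smul_smul, ← mul_inv, Real.mul_self_sqrt hM'.le, smul_eq_mul, inv_mul_cancel₀ hM'.ne']
  have h := measure_distill_eq Δ √(M : ℝ) (meanDir N) (meanDir_dotProduct_self hN)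
    (labelSign ω.1) _ hb hS
  rw [smul_smul, mul_inv_cancel₀ hM0, one_smul] at h
  exact h

/-- Limits in probability of functions of `distill` may be computed with `redVec`. -/
lemma tendsto_distill_of_redVec {Δ θ c : ℝ} {k : ℕ → ℕ} (hk : Tendsto k atTop atTop)
    [IsProbabilityMeasure (bern (1 / 2))] [IsProbabilityMeasure (bern θ)]
    {g : ∀ N : ℕ, (Fin N → ℝ) → ℝ} (hg : ∀ N, Measurable (g N))
    (h : Tendsto (fun p : Σ N, RedSpace N (k N) => g p.1 (redVec Δ p.2))
      (probFilter fun N => redMeasure N (k N) θ) (nhds c)) :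
    Tendsto (fun p : Σ N, TrainSpace N (k N) =>
        g p.1 (distill Δ (meanDir p.1) (labelSign p.2.1) (noisySign (p.2.1, p.2.2.1)) p.2.2.2))
      (probFilter fun N => trainMeasure N (k N) θ) (nhds c) := by
  rw [tendsto_probFilter_iff] at h ⊢
  intro ε hε
  refine (h ε hε).congr' ?_
  filter_upwards [eventually_gt_atTop 0, hk.eventually_gt_atTop 0] with N hN hM
  have hS : MeasurableSet {w : Fin N → ℝ | ε ≤ |g N w - c|} :=
    measurableSet_le measurable_const ((hg N).sub_const c).abs
  exact (trainMeasure_distill_eq hN hM hS).symm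

lemma w1_eq_smul_distill {N M : ℕ} (Δ : ℝ) (ω : TrainSpace N M) :
    w1 Δ ω = (1 / ((M : ℝ) ^ 2 * √N)) •
      distill Δ (meanDir N) (labelSign ω.1) (noisySign (ω.1, ω.2.1)) ω.2.2 := by
  have hx (μ : Fin M) : dataVec Δ ω μ = labelSign ω.1 μ • meanDir N + √Δ • ω.2.2 μ := by
    ext i
    simp only [dataVec, labelSign, meanDir, Pi.add_apply, Pi.smul_apply, smul_eq_mul]
    ring
  have hw : w0 Δ ω = (1 / (M : ℝ)) • ∑ μ, noisySign (ω.1, ω.2.1) μ • dataVec Δ ω μ := by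
    ext i
    simp only [w0, Pi.smul_apply, Finset.sum_apply, smul_eq_mul]
    rfl
  ext i
  have hin (μ : Fin M) : ∑ j, dataVec Δ ω μ j * w0 Δ ω j =
      1 / (M : ℝ) * (dataVec Δ ω μ ⬝ᵥ ∑ ν, noisySign (ω.1, ω.2.1) ν • dataVec Δ ω ν) := by
    rw [← smul_eq_mul, ← dotProduct_smul, ← hw]
    rfl
  simp only [w1, distill, hin, ← hx, Pi.smul_apply, Finset.sum_apply,
    smul_eq_mul, Finset.mul_sum]
  refine Finset.sum_congr rfl fun μ _ => ?_
  ring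

lemma genErr_smul_eq {N : ℕ} {Δ κ X Y c : ℝ} (hΔ : 0 < Δ) (hκ : 0 < κ) (hc : 0 < c)
    {w : Fin N → ℝ} (hX : meanDir N ⬝ᵥ w = c * X) (hY : w ⬝ᵥ w = c ^ 2 * Y) (hY0 : 0 < Y) :
    genErr N Δ (κ • w) = Hfun (X / √(Δ * Y)) := by
  have h1 : (κ • w) ⬝ᵥ (κ • w) = (κ * c) ^ 2 * Y := by
    rw [smul_dotProduct, dotProduct_smul, hY, smul_eq_mul, smul_eq_mul]; ring
  have hκc : 0 < κ * c := mul_pos hκ hc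
  rw [genErr_eq hΔ (h1 ▸ by positivity), h1, dotProduct_smul, hX, smul_eq_mul,
    mul_left_comm Δ, Real.sqrt_mul (sq_nonneg _), Real.sqrt_sq hκc.le, ← mul_assoc,
    mul_div_mul_left _ _ hκc.ne']

end Transfer

/-- **Appendix D Proposition, `t = 1` part.**
With `M = ⌈αN⌉`, the conditional generalization error of the one-step self-distilled
estimator `ŵ¹` converges in probability, as `N → ∞`, to
`H(α(Δ + α + Δα)(1 − 2θ) / √(Δ[(α² + 3α + 1)Δ³α + α²(Δ²(α² + 5α + 3) + Δ(2α + 3)α + α²)(1 − 2θ)²]))`. -/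
theorem stmt8 (Δ α θ : ℝ) (hΔ : 0 < Δ) (hα : 0 < α) (hθ0 : 0 ≤ θ) (hθ : θ < 1 / 2) :
    ∀ ε > (0 : ℝ),
      Tendsto
        (fun N : ℕ =>
          trainMeasure N (Nat.ceil (α * N)) θ
            {ω | ε ≤ |genErr N Δ (w1 Δ ω)
              - Hfun (α * (Δ + α + Δ * α) * (1 - 2 * θ)
                  / Real.sqrt (Δ * ((α ^ 2 + 3 * α + 1) * Δ ^ 3 * α
                      + α ^ 2 * (Δ ^ 2 * (α ^ 2 + 5 * α + 3) + Δ * (2 * α + 3) * α + α ^ 2)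
                        * (1 - 2 * θ) ^ 2)))|})
        atTop (nhds 0) := by
  intro ε hε
  have := isProbabilityMeasure_bern (p := 1 / 2) (by norm_num) (by norm_num)
  have := isProbabilityMeasure_bern hθ0 (by linarith)
  have hk := tendsto_ceil_mul hα
  obtain ⟨hm, hQ⟩ := tendsto_redVec hΔ hα hθ0 hθ hk (tendsto_ceil_mul_div hα.le)
  have hm := tendsto_distill_of_redVec hk (g := fun N w => (meanDir N ⬝ᵥ w) / (N : ℝ) ^ 2)
    (fun N => by simp only [dotProduct]; fun_prop) hm
  have hQ := tendsto_distill_of_redVec hk (g := fun N w => (w ⬝ᵥ w) / (N : ℝ) ^ 4)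
    (fun N => by simp only [dotProduct]; fun_prop) hQ
  have hQ0 : 0 < (α ^ 2 + 3 * α + 1) * Δ ^ 3 * α
      + α ^ 2 * (Δ ^ 2 * (α ^ 2 + 5 * α + 3) + Δ * (2 * α + 3) * α + α ^ 2) * (1 - 2 * θ) ^ 2 := by
    positivity
  have hlim := (continuous_Hfun.tendsto _).comp
    (hm.div (hQ.const_mul Δ).sqrt (Real.sqrt_pos.2 (mul_pos hΔ hQ0)).ne')
  refine tendsto_probFilter_iff (X := fun p : Σ N, TrainSpace N ⌈α * N⌉₊ =>
    genErr p.1 Δ (w1 Δ p.2)).1 (hlim.congr' ?_) ε hε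
  have hfst := tendsto_fst_probFilter (μ := fun N => trainMeasure N ⌈α * N⌉₊ θ)
  filter_upwards [hQ.eventually (lt_mem_nhds hQ0), hfst.eventually (eventually_gt_atTop 0),
    hfst.eventually (hk.eventually_gt_atTop 0)] with p hY hN hM
  have hN' : (0 : ℝ) < p.1 := by exact_mod_cast hN
  have hM' : (0 : ℝ) < ⌈α * p.1⌉₊ := by exact_mod_cast hM
  rw [w1_eq_smul_distill, genErr_smul_eq hΔ (by positivity) (pow_pos hN' 2)
    (mul_div_cancel₀ _ (pow_pos hN' 2).ne').symm
    (by rw [← pow_mul]; exact (mul_div_cancel₀ _ (pow_pos hN' 4).ne').symm) hY]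
  rfl
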